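/- Let b(z) = (1+z)/2 and let φ ∈ H(b) ∩ ball(H∞) with non-tangential limit φ(1) = 1, and set u(z) = (φ(z) − 1)/(z − 1). Then the following are equivalent: (i) the composition operator C_φ is bounded on H(b); (ii) φ has an angular derivative in the sense of Carathéodory at 1; (iii) u belongs to the de Branges–Rovnyak space H(φ). -/

import Mathlib

open Complex MeasureTheory Set Filter

noncomputable section

attribute [local instance] Classical.propDecidable

/-- The open unit disk in `ℂ`. -/
def unitDisk : Set ℂ := Metric.ball 0 1

/-- The unit circle in `ℂ`. -/
def unitCircle : Set ℂ := Metric.sphere 0 1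

/-- Membership in `H^∞`: analytic and bounded on the unit disk. -/
def MemHinf (f : ℂ → ℂ) : Prop :=
  DifferentiableOn ℂ f unitDisk ∧ ∃ C : ℝ, ∀ z ∈ unitDisk, ‖f z‖ ≤ C

/-- Membership in the closed unit ball of `H^∞`. -/
def MemBallHinf (f : ℂ → ℂ) : Prop :=
  DifferentiableOn ℂ f unitDisk ∧ ∀ z ∈ unitDisk, ‖f z‖ ≤ 1

/-- `f` agrees on the closed unit disk with a rational function without poles there. -/
def IsRationalOnDisk (f : ℂ → ℂ) : Prop :=
  ∃ P Q : Polynomial ℂ, ∀ z ∈ Metric.closedBall (0:ℂ) 1,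
    Q.eval z ≠ 0 ∧ f z = P.eval z / Q.eval z

/-- `f` is a finite Blaschke product (multiplicities are encoded by repetition). -/
def IsFiniteBlaschke (f : ℂ → ℂ) : Prop :=
  ∃ (γ : ℂ) (k : ℕ) (lam : Fin k → ℂ), ‖γ‖ = 1 ∧ (∀ i, lam i ∈ unitDisk) ∧
    ∀ z ∈ unitDisk, f z = γ * ∏ i, (z - lam i) / (1 - (starRingEnd ℂ) (lam i) * z)

/-- The `k`-th Taylor coefficient of `f` at the origin. -/
def taylorCoeff (f : ℂ → ℂ) (k : ℕ) : ℂ := iteratedDeriv k f 0 / k.factorial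

/-- Membership in the Hardy space `H²` (square-summable Taylor coefficients). -/
def MemH2 (f : ℂ → ℂ) : Prop :=
  DifferentiableOn ℂ f unitDisk ∧ Summable fun k => ‖taylorCoeff f k‖ ^ 2

/-- The squared `H²` norm. -/
def h2NormSq (f : ℂ → ℂ) : ℝ := ∑' k, ‖taylorCoeff f k‖ ^ 2

/-- The `H²` inner product. -/
def h2Inner (f g : ℂ → ℂ) : ℂ :=
  ∑' k, (starRingEnd ℂ) (taylorCoeff f k) * taylorCoeff g k

/-- The polynomial `a₁(z) = ∏ⱼ (z − ξⱼ)^{mⱼ}`. -/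
def a1fun {n : ℕ} (ξ : Fin n → ℂ) (m : Fin n → ℕ) : ℂ → ℂ :=
  fun z => ∏ j, (z - ξ j) ^ (m j)

/-- A decomposition `f = a₁ g + q` with `g ∈ H²`, `deg q ≤ N − 1`, witnessing membership
in `H(b) = a₁H² ⊕ P_{N−1}`. -/
def HbDecompOf {n : ℕ} (ξ : Fin n → ℂ) (m : Fin n → ℕ)
    (f g : ℂ → ℂ) (q : Polynomial ℂ) : Prop :=
  MemH2 g ∧ q.degree < ((∑ j, m j : ℕ) : WithBot ℕ) ∧
    ∀ z ∈ unitDisk, f z = a1fun ξ m z * g z + q.eval z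

/-- Membership in `H(b) = a₁ H² ⊕ P_{N−1}` (description of `H(b)` for `b` rational,
not a finite Blaschke product, whose pythagorean mate has boundary zeros `ξ` with
multiplicities `m`). -/
def MemHb {n : ℕ} (ξ : Fin n → ℂ) (m : Fin n → ℕ) (f : ℂ → ℂ) : Prop :=
  ∃ gq : (ℂ → ℂ) × Polynomial ℂ, HbDecompOf ξ m f gq.1 gq.2

/-- The (unique) decomposition of a member of `H(b)`. -/
def hbDecomp {n : ℕ} (ξ : Fin n → ℂ) (m : Fin n → ℕ) (f : ℂ → ℂ) :
    (ℂ → ℂ) × Polynomial ℂ :=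
  if h : MemHb ξ m f then h.choose else (0, 0)

/-- The squared norm `⦀a₁g + q⦀² = ‖g‖²_{H²} + ‖q‖²_{H²}` on `H(b)`. -/
def hbNormSq {n : ℕ} (ξ : Fin n → ℂ) (m : Fin n → ℕ) (f : ℂ → ℂ) : ℝ :=
  h2NormSq (hbDecomp ξ m f).1 + h2NormSq fun z => ((hbDecomp ξ m f).2).eval z

/-- The inner product on `H(b)` induced by the decomposition. -/
def hbInner {n : ℕ} (ξ : Fin n → ℂ) (m : Fin n → ℕ) (f g : ℂ → ℂ) : ℂ :=
  h2Inner (hbDecomp ξ m f).1 (hbDecomp ξ m g).1 +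
    h2Inner (fun z => ((hbDecomp ξ m f).2).eval z)
      (fun z => ((hbDecomp ξ m g).2).eval z)

/-- The Stolz angle (non-tangential approach region) at a boundary point `ξ`. -/
def stolzAngle (ξ : ℂ) (M : ℝ) : Set ℂ := {z ∈ unitDisk | ‖z - ξ‖ ≤ M * (1 - ‖z‖)}

/-- `f` has non-tangential limit `L` at `ξ`. -/
def NTLimit (f : ℂ → ℂ) (ξ L : ℂ) : Prop :=
  ∀ M : ℝ, 1 < M → Tendsto f (nhdsWithin ξ (stolzAngle ξ M)) (nhds L)

/-- Radial boundary value of `f` at `ζ` (junk value if the radial limit does not exist). -/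
def bdryVal (f : ℂ → ℂ) (ζ : ℂ) : ℂ :=
  limUnder (nhdsWithin (1:ℝ) (Set.Iio 1)) fun r : ℝ => f ((r : ℂ) * ζ)

/-- The full setting: `b` is a rational function in the closed unit ball of `H^∞` with
`‖b‖_∞ = 1` which is not a finite Blaschke product; `a` is its pythagorean mate (rational,
outer — i.e. zero-free on the disk —, `a(0) > 0`, `|a|² + |b|² = 1` on the circle); the
`ξ j` are the distinct zeros of `a` on the unit circle, with multiplicities `m j`. -/
structure RationalSetting (b a : ℂ → ℂ) (n : ℕ) (ξ : Fin n → ℂ) (m : Fin n → ℕ) :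
    Prop where
  b_diff : DifferentiableOn ℂ b unitDisk
  b_rat : IsRationalOnDisk b
  b_le_one : ∀ z ∈ unitDisk, ‖b z‖ ≤ 1
  b_norm_one : sSup ((fun z => ‖b z‖) '' unitDisk) = 1
  b_not_fbp : ¬ IsFiniteBlaschke b
  a_diff : DifferentiableOn ℂ a unitDisk
  a_rat : IsRationalOnDisk a
  a_outer : ∀ z ∈ unitDisk, a z ≠ 0
  a_zero_pos : 0 < (a 0).re ∧ (a 0).im = 0
  pyth : ∀ ζ ∈ unitCircle, ‖a ζ‖ ^ 2 + ‖b ζ‖ ^ 2 = 1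
  zeros_mem : ∀ j, ξ j ∈ unitCircle
  zeros_inj : Function.Injective ξ
  mult_pos : ∀ j, 0 < m j
  factor : ∃ g : ℂ → ℂ, IsRationalOnDisk g ∧ (∀ ζ ∈ unitCircle, g ζ ≠ 0) ∧
    ∀ z ∈ Metric.closedBall (0:ℂ) 1, a z = a1fun ξ m z * g z

/-- The composition operator `C_φ` maps `H(b)` into itself and is bounded there
(with respect to the equivalent norm `⦀·⦀_b`). -/
def CompBddHb {n : ℕ} (ξ : Fin n → ℂ) (m : Fin n → ℕ) (φ : ℂ → ℂ) : Prop :=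
  (∀ f, MemHb ξ m f → MemHb ξ m fun z => f (φ z)) ∧
  ∃ C : ℝ, ∀ f, MemHb ξ m f →
    hbNormSq ξ m (fun z => f (φ z)) ≤ C * hbNormSq ξ m f

/-- The composition operator `C_φ` is compact on `H(b)`: it is bounded and the image of
every sequence in the unit ball has a subsequence whose image converges in `H(b)`. -/
def CompCompactHb {n : ℕ} (ξ : Fin n → ℂ) (m : Fin n → ℕ) (φ : ℂ → ℂ) : Prop :=
  CompBddHb ξ m φ ∧
  ∀ f : ℕ → ℂ → ℂ, (∀ k, MemHb ξ m (f k) ∧ hbNormSq ξ m (f k) ≤ 1) →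
    ∃ (κ : ℕ → ℕ) (g : ℂ → ℂ), StrictMono κ ∧ MemHb ξ m g ∧
      Tendsto (fun i => hbNormSq ξ m fun z => f (κ i) (φ z) - g z) atTop (nhds 0)

/-- The composition operator `C_φ` is Hilbert–Schmidt on `H(b)`: it is bounded and the sum
of `⦀C_φ e⦀²` over the orthonormal basis `{a₁ z^k}ₖ ∪ {z^j}_{j<N}` of
`(H(b), ⦀·⦀_b)` is finite (the finite part of the sum being automatically finite). -/
def CompHSHb {n : ℕ} (ξ : Fin n → ℂ) (m : Fin n → ℕ) (φ : ℂ → ℂ) : Prop :=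
  CompBddHb ξ m φ ∧
  Summable fun k : ℕ => hbNormSq ξ m fun z => a1fun ξ m (φ z) * φ z ^ k

/-- The weighted composition operator `W_{u,φ} f = u · (f ∘ φ)` maps `H²` boundedly
into itself. -/
def WCompBddH2 (u φ : ℂ → ℂ) : Prop :=
  (∀ f, MemH2 f → MemH2 fun z => u z * f (φ z)) ∧
  ∃ C : ℝ, ∀ f, MemH2 f →
    h2NormSq (fun z => u z * f (φ z)) ≤ C * h2NormSq f

/-- The weighted composition operator `W_{u,φ}` is compact on `H²`. -/
def WCompCompactH2 (u φ : ℂ → ℂ) : Prop :=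
  WCompBddH2 u φ ∧
  ∀ f : ℕ → ℂ → ℂ, (∀ k, MemH2 (f k) ∧ h2NormSq (f k) ≤ 1) →
    ∃ (κ : ℕ → ℕ) (g : ℂ → ℂ), StrictMono κ ∧ MemH2 g ∧
      Tendsto (fun i => h2NormSq fun z => u z * f (κ i) (φ z) - g z) atTop (nhds 0)

/-- The weighted composition operator `W_{u,φ}` is Hilbert–Schmidt on `H²`
(sum over the orthonormal basis `{z^k}` of `H²`). -/
def WCompHSH2 (u φ : ℂ → ℂ) : Prop :=
  WCompBddH2 u φ ∧ Summable fun k : ℕ => h2NormSq fun z => u z * φ z ^ k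

/-- The function `u = (a₁ ∘ φ) · ∏_{j ≥ p} (φ − φ(ξⱼ))^{mⱼ} / a₁`, where `Λ j = φ(ξ j)`
are the non-tangential limits of `φ` at the zeros of the mate. -/
def ufun {n : ℕ} (p : ℕ) (ξ : Fin n → ℂ) (m : Fin n → ℕ) (Λ : Fin n → ℂ)
    (φ : ℂ → ℂ) : ℂ → ℂ :=
  fun z => a1fun ξ m (φ z) *
    (∏ j ∈ Finset.univ.filter fun j : Fin n => p ≤ (j : ℕ), (φ z - Λ j) ^ (m j)) /
      a1fun ξ m z

/-- The reproducing kernel of the de Branges–Rovnyak space `H(c)`: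
`k_λ^c(z) = (1 − conj(c(λ)) c(z)) / (1 − conj(λ) z)`, as a function of the parameter `λ`
and the evaluation point `z`. -/
def rkKernel (c : ℂ → ℂ) (lam z : ℂ) : ℂ :=
  (1 - (starRingEnd ℂ) (c lam) * c z) / (1 - (starRingEnd ℂ) lam * z)

/-- `f` belongs to the reproducing kernel Hilbert space `H(c)` with squared norm at
most `t`: for all finite linear combinations of kernels,
`|⟨f, Σ αᵢ k_{λᵢ}⟩|² ≤ t · ‖Σ αᵢ k_{λᵢ}‖²`. -/
def HbRKBound (c f : ℂ → ℂ) (t : ℝ) : Prop :=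
  ∀ (k : ℕ) (lam α : Fin k → ℂ), (∀ i, lam i ∈ unitDisk) →
    ‖∑ i, (starRingEnd ℂ) (α i) * f (lam i)‖ ^ 2 ≤
      t * (∑ i, ∑ j, α i * (starRingEnd ℂ) (α j) * rkKernel c (lam i) (lam j)).re

/-- Membership in the de Branges–Rovnyak space `H(c)` (general RKHS definition). -/
def MemHbRK (c f : ℂ → ℂ) : Prop := ∃ t : ℝ, HbRKBound c f t

/-- `φ` has an angular derivative in the sense of Carathéodory at `ξ`:
`φ` and `φ'` have non-tangential limits at `ξ` and `|φ(ξ)| = 1`. -/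
def HasADC (φ : ℂ → ℂ) (ξ : ℂ) : Prop :=
  ∃ L L' : ℂ, ‖L‖ = 1 ∧ NTLimit φ ξ L ∧ NTLimit (deriv φ) ξ L'

/-- The measure `μ_{u,φ}(E) = ∫_{φ⁻¹(E) ∩ T} |u|² dm` (boundary values on the circle,
normalized Lebesgue measure). -/
def muMeas (u φ : ℂ → ℂ) (E : Set ℂ) : ENNReal :=
  (ENNReal.ofReal (2 * Real.pi))⁻¹ *
    ∫⁻ θ in Set.Ioc (0:ℝ) (2 * Real.pi),
      (if bdryVal φ (Complex.exp (θ * Complex.I)) ∈ E then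
        ENNReal.ofReal (‖bdryVal u (Complex.exp (θ * Complex.I))‖ ^ 2) else 0)

/-- `μ_{u,φ}` is a Carleson measure: `μ(S(ζ,r)) ≤ M r` for all Carleson windows
`S(ζ,r) = {z : |z| ≤ 1, |z − ζ| ≤ r}`, `ζ ∈ T`, `0 < r < 1`. -/
def IsCarleson (u φ : ℂ → ℂ) : Prop :=
  ∃ M : ℝ, 0 < M ∧ ∀ ζ ∈ unitCircle, ∀ r ∈ Set.Ioo (0:ℝ) 1,
    muMeas u φ (Metric.closedBall ζ r ∩ Metric.closedBall 0 1) ≤ ENNReal.ofReal (M * r)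

/-- `μ_{u,φ}` is a vanishing Carleson measure: `sup_{ζ∈T} μ(S(ζ,r))/r → 0` as `r → 0`. -/
def IsVanishingCarleson (u φ : ℂ → ℂ) : Prop :=
  ∀ ε > (0:ℝ), ∃ r₀ ∈ Set.Ioo (0:ℝ) 1, ∀ r ∈ Set.Ioo (0:ℝ) r₀, ∀ ζ ∈ unitCircle,
    muMeas u φ (Metric.closedBall ζ r ∩ Metric.closedBall 0 1) ≤ ENNReal.ofReal (ε * r)

/-- The reproducing kernel integral
`∫_T (1 − |w|²) |u(ξ)|² / |1 − conj(w) φ(ξ)|² dm(ξ)`. -/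
def repKerInt (u φ : ℂ → ℂ) (w : ℂ) : ENNReal :=
  (ENNReal.ofReal (2 * Real.pi))⁻¹ *
    ∫⁻ θ in Set.Ioc (0:ℝ) (2 * Real.pi),
      ENNReal.ofReal ((1 - ‖w‖ ^ 2) * ‖bdryVal u (Complex.exp (θ * Complex.I))‖ ^ 2 /
        ‖1 - (starRingEnd ℂ) w * bdryVal φ (Complex.exp (θ * Complex.I))‖ ^ 2)

lemma l2_seq_contr (b c : ℕ → ℂ) (hb : Summable fun n => ‖b n‖) (hc : Summable fun n => ‖c n‖)
    (B : ℝ) (hB : 0 ≤ B)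
    (h : ∀ ζ : ℂ, ‖ζ‖ = 1 → ‖∑' n, b n * ζ ^ n‖ ≤ B * ‖∑' n, c n * ζ ^ n‖) :
    Summable (fun n => ‖b n‖ ^ 2) ∧ Summable (fun n => ‖c n‖ ^ 2) ∧
    ∑' n, ‖b n‖ ^ 2 ≤ B ^ 2 * ∑' n, ‖c n‖ ^ 2 := by
  have : Fact (0 < 2 * Real.pi) := ⟨by positivity⟩
  have key : ∀ b : ℕ → ℂ, Summable (fun n => ‖b n‖) →
      ∃ f : C(AddCircle (2 * Real.pi), ℂ), 
        (∀ x, f x = ∑' n, b n * ((AddCircle.toCircle x : ℂ)) ^ n) ∧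
        HasSum (fun n => ‖b n‖ ^ 2)
          (‖ContinuousMap.toLp 2 (AddCircle.haarAddCircle (T := 2 * Real.pi)) ℂ f‖ ^ 2) := by
    intro b hb
    have hs : Summable fun n : ℕ => b n • fourier (T := 2 * Real.pi) (n : ℤ) := by
      apply Summable.of_norm
      simpa [norm_smul, fourier_norm] using hb
    refine ⟨∑' n : ℕ, b n • fourier (T := 2 * Real.pi) (n : ℤ), ?_, ?_⟩
    · intro x
      have := (ContinuousMap.evalCLM ℂ x).map_tsum hs
      simp only [ContinuousMap.evalCLM_apply] at this
      rw [this]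
      congr 1; ext n
      simp [fourier_apply, AddCircle.toCircle_nsmul]
    · set L := ContinuousMap.toLp (E := ℂ) 2 (AddCircle.haarAddCircle (T := 2 * Real.pi)) ℂ
      have h1 := hs.hasSum.mapL L
      simp only [map_smul] at h1
      have ho : Orthonormal ℂ (fun n : ℕ => fourierLp (T := 2 * Real.pi) 2 (n : ℤ)) :=
        orthonormal_fourier.comp _ Nat.cast_injective
      have hm : Memℓp b 2 := by
        have h1 : Memℓp b 1 := by
          apply memℓp_gen; simpa using hb
        exact h1.of_exponent_ge (by norm_num)
      have h2 := ho.orthogonalFamily.hasSum_linearIsometry ⟨b, hm⟩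
      have h3 : L (∑' n : ℕ, b n • fourier (T := 2 * Real.pi) (n : ℤ)) = 
          ho.orthogonalFamily.linearIsometry ⟨b, hm⟩ := h1.unique (by simpa using h2)
      rw [h3, LinearIsometry.norm_map]
      have := lp.hasSum_norm (p := 2) (by norm_num) (⟨b, hm⟩ : lp (fun _ : ℕ => ℂ) 2)
      simpa using this
  obtain ⟨f, hf, hf2⟩ := key b hb
  obtain ⟨g, hg, hg2⟩ := key c hc
  refine ⟨hf2.summable, hg2.summable, ?_⟩
  rw [hf2.tsum_eq, hg2.tsum_eq, ← mul_pow]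
  gcongr
  apply Lp.norm_le_mul_norm_of_ae_le_mul
  filter_upwards [ContinuousMap.coeFn_toLp (p := 2) (𝕜 := ℂ) (AddCircle.haarAddCircle (T := 2 * Real.pi)) f,
    ContinuousMap.coeFn_toLp (p := 2) (𝕜 := ℂ) (AddCircle.haarAddCircle (T := 2 * Real.pi)) g] with x h1 h2
  rw [h1, h2, hf, hg]
  exact h _ (Circle.norm_coe _)

lemma hasSum_taylorCoeff {f : ℂ → ℂ} (hf : DifferentiableOn ℂ f unitDisk) {z : ℂ}
    (hz : z ∈ unitDisk) : HasSum (fun n => taylorCoeff f n * z ^ n) (f z) := by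
  have := Complex.hasSum_taylorSeries_on_ball (c := 0) (r := 1) (f := f) (z := z) hf hz
  have e : (fun n => taylorCoeff f n * z ^ n) = (fun n : ℕ ↦ (n.factorial : ℂ)⁻¹ • (z - 0) ^ n • iteratedDeriv n f 0) := by
    ext n
    simp only [taylorCoeff, sub_zero, smul_eq_mul]; ring
  rw [e]; exact this

lemma mem_unitDisk {z : ℂ} : z ∈ unitDisk ↔ ‖z‖ < 1 := by simp [unitDisk]

lemma summable_taylorCoeff {f : ℂ → ℂ} (hf : DifferentiableOn ℂ f unitDisk) {r : ℝ} (hr0 : 0 ≤ r)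
    (hr : r < 1) : Summable (fun n => ‖taylorCoeff f n * (r : ℂ) ^ n‖) :=
  (hasSum_taylorCoeff hf (z := r) (by simp [mem_unitDisk, abs_of_nonneg hr0, hr])).summable.norm

lemma summable_of_r {a : ℕ → ℂ} {M : ℝ} (h : ∀ r : ℝ, 0 ≤ r → r < 1 →
    Summable (fun n => ‖a n * (r : ℂ) ^ n‖ ^ 2) ∧ ∑' n, ‖a n * (r : ℂ) ^ n‖ ^ 2 ≤ M) :
    Summable (fun n => ‖a n‖ ^ 2) ∧ ∑' n, ‖a n‖ ^ 2 ≤ M := by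
  have key : ∀ s : Finset ℕ, ∑ n ∈ s, ‖a n‖ ^ 2 ≤ M := by
    intro s
    have hc : Continuous fun r : ℝ => ∑ n ∈ s, ‖a n * (r : ℂ) ^ n‖ ^ 2 := by fun_prop
    have ht : Tendsto (fun r : ℝ => ∑ n ∈ s, ‖a n * (r : ℂ) ^ n‖ ^ 2) (nhdsWithin 1 (Iio 1))
        (nhds (∑ n ∈ s, ‖a n‖ ^ 2)) := by
      have := (hc.tendsto 1).mono_left (nhdsWithin_le_nhds (s := Iio 1))
      simpa using this
    refine le_of_tendsto ht ?_
    filter_upwards [Ioo_mem_nhdsLT (show (0:ℝ) < 1 by norm_num)] with r hr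
    obtain ⟨h1, h2⟩ := h r hr.1.le hr.2
    exact (h1.sum_le_tsum s (fun _ _ => by positivity)).trans h2
  have hs : Summable (fun n => ‖a n‖ ^ 2) := summable_of_sum_le (fun _ => by positivity) key
  exact ⟨hs, hs.tsum_le_of_sum_le key⟩

lemma memH2_mul {m f : ℂ → ℂ} (hm : DifferentiableOn ℂ m unitDisk) {B : ℝ} (hB : 0 ≤ B)
    (hmB : ∀ z ∈ unitDisk, ‖m z‖ ≤ B) (hf : MemH2 f) :
    MemH2 (fun z => m z * f z) ∧ h2NormSq (fun z => m z * f z) ≤ B ^ 2 * h2NormSq f := by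
  have hd : DifferentiableOn ℂ (fun z => m z * f z) unitDisk := hm.mul hf.1
  have : Summable (fun n => ‖taylorCoeff (fun z => m z * f z) n‖ ^ 2) ∧
      ∑' n, ‖taylorCoeff (fun z => m z * f z) n‖ ^ 2 ≤ B ^ 2 * h2NormSq f := by
    apply summable_of_r
    intro r hr0 hr
    obtain ⟨h1, h2, h3⟩ := l2_seq_contr _ _ (summable_taylorCoeff hd hr0 hr)
      (summable_taylorCoeff hf.1 hr0 hr) B hB (by
        intro ζ hζ
        have hz : (r : ℂ) * ζ ∈ unitDisk := by simp [mem_unitDisk, hζ, abs_of_nonneg hr0, hr]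
        have e1 := (hasSum_taylorCoeff hd hz).tsum_eq
        have e2 := (hasSum_taylorCoeff hf.1 hz).tsum_eq
        simp only [mul_pow, ← mul_assoc] at e1 e2
        rw [e1, e2, norm_mul]
        gcongr
        exact hmB _ hz)
    refine ⟨h1, h3.trans ?_⟩
    gcongr
    refine h2.tsum_le_tsum ?_ hf.2
    intro n
    rw [norm_mul, mul_pow]
    have : ‖(r : ℂ) ^ n‖ ≤ 1 := by
      rw [norm_pow]; exact pow_le_one₀ (norm_nonneg _) (by simp [abs_of_nonneg hr0, hr.le])
    have h4 : ‖(r : ℂ) ^ n‖ ^ 2 ≤ 1 := pow_le_one₀ (norm_nonneg _) this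
    exact mul_le_of_le_one_right (by positivity) h4
  exact ⟨⟨hd, this.1⟩, this.2⟩

lemma taylor_of_hasSum {a : ℕ → ℂ} {f : ℂ → ℂ}
    (h : ∀ z ∈ unitDisk, HasSum (fun n => a n * z ^ n) (f z)) :
    DifferentiableOn ℂ f unitDisk ∧ ∀ n, taylorCoeff f n = a n := by
  set p := FormalMultilinearSeries.ofScalars ℂ a
  have hp : HasFPowerSeriesOnBall f p 0 1 := by
    refine ⟨?_, by norm_num, ?_⟩
    · refine ENNReal.le_of_forall_nnreal_lt fun r hr => ?_
      have hr1 : (r : ℝ) < 1 := by exact_mod_cast hr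
      apply p.le_radius_of_summable
      have := (h (r : ℂ) (by simpa [mem_unitDisk] using hr1)).summable.norm
      refine this.congr fun n => ?_
      simp [p]
    · intro y hy
      have hy' : y ∈ unitDisk := by
        simpa [mem_unitDisk, Metric.mem_eball, edist_zero_right, ← ofReal_norm, ENNReal.ofReal_lt_one] using hy
      rw [zero_add]
      refine (h y hy').congr_fun fun n => ?_
      simp [p, mul_comm]
  refine ⟨?_, fun n => ?_⟩
  · have := hp.differentiableOn
    refine this.mono fun y hy => ?_
    simpa [mem_unitDisk, Metric.mem_eball, edist_zero_right, ← ofReal_norm, ENNReal.ofReal_lt_one] using hy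
  · have h1 := hp.factorial_smul 1 n
    rw [← iteratedDeriv_eq_iteratedFDeriv, FormalMultilinearSeries.ofScalars_apply_eq] at h1
    rw [taylorCoeff, ← h1]
    have : (n.factorial : ℂ) ≠ 0 := by exact_mod_cast n.factorial_ne_zero
    simp only [one_pow, smul_eq_mul, mul_one, nsmul_eq_mul]
    field_simp

/-- The Szego kernel vector. -/
def kv (l : ℂ) : lp (fun _ : ℕ => ℂ) 2 :=
  if h : ‖l‖ < 1 then ⟨fun n => (starRingEnd ℂ) l ^ n, by
    apply memℓp_gen
    have : Summable fun n : ℕ => (‖l‖ ^ 2) ^ n :=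
      summable_geometric_of_lt_one (by positivity) (pow_lt_one₀ (norm_nonneg _) h (by norm_num))
    refine this.congr fun n => ?_
    simp [← pow_mul, mul_comm]⟩ else 0

lemma kv_apply {l : ℂ} (h : ‖l‖ < 1) (n : ℕ) : kv l n = (starRingEnd ℂ) l ^ n := by
  rw [kv, dif_pos h]

lemma kv_hasSum {l : ℂ} (h : ‖l‖ < 1) (g : lp (fun _ : ℕ => ℂ) 2) :
    HasSum (fun n => g n * l ^ n) (inner ℂ (kv l) g) := by
  have := lp.hasSum_inner (𝕜 := ℂ) (kv l) g
  simpa [kv_apply h] using this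

lemma kv_inner_kv {l z : ℂ} (h : ‖l‖ < 1) (hz : ‖z‖ < 1) :
    inner ℂ (kv z) (kv l) = 1 / (1 - (starRingEnd ℂ) l * z) := by
  have h1 := kv_hasSum hz (kv l)
  have h2 : HasSum (fun n : ℕ => ((starRingEnd ℂ) l * z) ^ n) (1 - (starRingEnd ℂ) l * z)⁻¹ :=
    hasSum_geometric_of_norm_lt_one (by
      rw [norm_mul, RCLike.norm_conj]; nlinarith [norm_nonneg l, norm_nonneg z])
  rw [one_div]
  refine h1.unique ?_
  simpa [kv_apply h, mul_pow] using h2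

lemma kv_norm_sq {l : ℂ} (h : ‖l‖ < 1) : ‖kv l‖ ^ 2 = 1 / (1 - ‖l‖ ^ 2) := by
  have := kv_inner_kv h h
  rw [inner_self_eq_norm_sq_to_K, mul_comm, Complex.mul_conj, Complex.normSq_eq_norm_sq] at this
  apply Complex.ofReal_injective
  push_cast at this ⊢
  exact this

def toL2 (f : ℂ → ℂ) (hf : MemH2 f) : lp (fun _ : ℕ => ℂ) 2 :=
  ⟨fun n => taylorCoeff f n, by apply memℓp_gen; simpa using hf.2⟩

lemma toL2_norm (f : ℂ → ℂ) (hf : MemH2 f) : ‖toL2 f hf‖ ^ 2 = h2NormSq f := by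
  have := lp.hasSum_norm (p := 2) (by norm_num) (toL2 f hf)
  have h2 : HasSum (fun n => ‖taylorCoeff f n‖ ^ 2) (‖toL2 f hf‖ ^ 2) := by
    simpa [toL2] using this
  exact h2.tsum_eq.symm

lemma toL2_inner (f : ℂ → ℂ) (hf : MemH2 f) {z : ℂ} (hz : ‖z‖ < 1) :
    inner ℂ (kv z) (toL2 f hf) = f z :=
  (kv_hasSum hz (toL2 f hf)).unique (hasSum_taylorCoeff hf.1 (mem_unitDisk.2 hz))

lemma memH2_of_l2 {f : ℂ → ℂ} (g : lp (fun _ : ℕ => ℂ) 2)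
    (h : ∀ z ∈ unitDisk, f z = inner ℂ (kv z) g) : MemH2 f ∧ h2NormSq f = ‖g‖ ^ 2 := by
  obtain ⟨h1, h2⟩ := taylor_of_hasSum (a := fun n => g n) (f := f) (fun z hz => by
    rw [h z hz]; exact kv_hasSum (mem_unitDisk.1 hz) g)
  have := lp.hasSum_norm (p := 2) (by norm_num) g
  have h3 : HasSum (fun n => ‖taylorCoeff f n‖ ^ 2) (‖g‖ ^ 2) := by
    simpa [h2] using this
  exact ⟨⟨h1, h3.summable⟩, h3.tsum_eq⟩

lemma h2_point {f : ℂ → ℂ} (hf : MemH2 f) {z : ℂ} (hz : ‖z‖ < 1) :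
    ‖f z‖ ^ 2 * (1 - ‖z‖ ^ 2) ≤ h2NormSq f := by
  have h0 : 0 < 1 - ‖z‖ ^ 2 := by nlinarith [norm_nonneg z]
  have h1 := norm_inner_le_norm (𝕜 := ℂ) (kv z) (toL2 f hf)
  rw [toL2_inner f hf hz] at h1
  have h2 : ‖f z‖ ^ 2 ≤ ‖kv z‖ ^ 2 * ‖toL2 f hf‖ ^ 2 := by
    rw [← mul_pow]; gcongr
  rw [kv_norm_sq hz, toL2_norm, one_div, inv_mul_eq_div, le_div_iff₀ h0] at h2
  exact h2

/-- Positivity of the de Branges-Rovnyak kernel. -/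
lemma rk_pos {φ : ℂ → ℂ} (hφ : MemBallHinf φ) (k : ℕ) (lam α : Fin k → ℂ)
    (hl : ∀ i, lam i ∈ unitDisk) :
    0 ≤ (∑ i, ∑ j, α i * (starRingEnd ℂ) (α j) * rkKernel φ (lam i) (lam j)).re := by
  have hl' : ∀ i, ‖lam i‖ < 1 := fun i => mem_unitDisk.1 (hl i)
  set h : lp (fun _ : ℕ => ℂ) 2 := ∑ i, α i • kv (lam i) with hh
  set h' : lp (fun _ : ℕ => ℂ) 2 := ∑ i, (α i * (starRingEnd ℂ) (φ (lam i))) • kv (lam i) with hh'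
  have e : ∑ i, ∑ j, α i * (starRingEnd ℂ) (α j) * rkKernel φ (lam i) (lam j) =
      inner ℂ h h - inner ℂ h' h' := by
    simp only [hh, hh', sum_inner, inner_sum, inner_smul_left, inner_smul_right, Finset.mul_sum]
    rw [← Finset.sum_sub_distrib]
    refine Finset.sum_congr rfl fun i _ => ?_
    rw [← Finset.sum_sub_distrib]
    refine Finset.sum_congr rfl fun j _ => ?_
    rw [kv_inner_kv (hl' i) (hl' j), rkKernel]
    simp only [map_mul, Complex.conj_conj]
    ring
  obtain ⟨hf, hfn⟩ := memH2_of_l2 (f := fun z => inner ℂ (kv z) h') h' (fun z _ => rfl)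
  obtain ⟨hF, hFn⟩ := memH2_mul hφ.1 zero_le_one hφ.2 hf
  have e2 : inner ℂ h (toL2 _ hF) = inner ℂ h' h' := by
    rw [hh, sum_inner]
    conv_rhs => rw [hh', sum_inner]
    rw [← hh']
    refine Finset.sum_congr rfl fun i _ => ?_
    rw [inner_smul_left, inner_smul_left, toL2_inner _ _ (hl' i)]
    simp only [map_mul, Complex.conj_conj]
    ring
  have h3 : ‖toL2 _ hF‖ ≤ ‖h'‖ := by
    apply le_of_sq_le_sq _ (norm_nonneg _)
    rw [toL2_norm, ← hfn]; simpa using hFn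
  have h4 := norm_inner_le_norm (𝕜 := ℂ) h (toL2 _ hF)
  rw [e2] at h4
  rw [e, Complex.sub_re]
  have h5 : ‖inner ℂ h' h'‖ = ‖h'‖ ^ 2 := by
    rw [inner_self_eq_norm_sq_to_K]; simp
  have h6 : (inner ℂ h h).re = ‖h‖ ^ 2 := by
    rw [inner_self_eq_norm_sq_to_K]; norm_cast
  have h7 : (inner ℂ h' h').re = ‖h'‖ ^ 2 := by
    rw [inner_self_eq_norm_sq_to_K]; norm_cast
  rw [h5] at h4
  rw [h6, h7]
  have h8 : ‖h'‖ ^ 2 ≤ ‖h‖ * ‖h'‖ := h4.trans (by gcongr)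
  nlinarith [norm_nonneg h, norm_nonneg h', sq_nonneg (‖h‖ - ‖h'‖)]

/-- Bounded functionals on spans of kernels are represented. -/
lemma riesz_rep {F : ℂ → ℂ} {t : ℝ} (ht : 0 ≤ t)
    (h : ∀ (k : ℕ) (lam α : Fin k → ℂ), (∀ i, lam i ∈ unitDisk) →
      ‖∑ i, (starRingEnd ℂ) (α i) * F (lam i)‖ ^ 2 ≤ t * ‖∑ i, α i • kv (lam i)‖ ^ 2) :
    MemH2 F ∧ h2NormSq F ≤ t := by
  let T : (unitDisk →₀ ℂ) →ₗ[ℂ] lp (fun _ : ℕ => ℂ) 2 :=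
    Finsupp.linearCombination ℂ (fun l : unitDisk => kv l)
  let L : (unitDisk →₀ ℂ) →ₗ[ℂ] ℂ :=
    Finsupp.linearCombination ℂ (fun l : unitDisk => (starRingEnd ℂ) (F l))
  have hb : ∀ x, ‖L x‖ ≤ Real.sqrt t * ‖T x‖ := by
    intro x
    have := h x.support.card (fun i => ((x.support.equivFin.symm i : unitDisk) : ℂ))
      (fun i => x (x.support.equivFin.symm i)) (fun i => Subtype.property _)
    have e1 : ∑ i, (x (x.support.equivFin.symm i)) • kv ((x.support.equivFin.symm i : unitDisk) : ℂ)
        = T x := by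
      rw [Finsupp.linearCombination_apply, Finsupp.sum,
        x.support.equivFin.symm.sum_comp (fun i => x i • kv ((i : unitDisk) : ℂ)),
        Finset.sum_coe_sort x.support (fun i => x i • kv (i : ℂ))]
    have e2 : ∑ i, (starRingEnd ℂ) (x (x.support.equivFin.symm i)) * 
        F ((x.support.equivFin.symm i : unitDisk) : ℂ) = (starRingEnd ℂ) (L x) := by
      rw [Finsupp.linearCombination_apply, Finsupp.sum,
        x.support.equivFin.symm.sum_comp (fun i => (starRingEnd ℂ) (x i) * F ((i : unitDisk) : ℂ)),
        Finset.sum_coe_sort x.support (fun i => (starRingEnd ℂ) (x i) * F (i : ℂ))]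
      simp
    rw [e1, e2, RCLike.norm_conj] at this
    apply le_of_sq_le_sq _ (by positivity)
    rwa [mul_pow, Real.sq_sqrt ht]
  have hker : LinearMap.ker T.rangeRestrict ≤ LinearMap.ker L := by
    intro x hx
    rw [LinearMap.ker_rangeRestrict, LinearMap.mem_ker] at hx
    have := hb x
    rw [hx] at this
    simpa using this
  obtain ⟨ℓ, hℓ⟩ : ∃ ℓ : LinearMap.range T →ₗ[ℂ] ℂ, ∀ x, ℓ (T.rangeRestrict x) = L x := by
    obtain ⟨s, hs⟩ := T.rangeRestrict.exists_rightInverse_of_surjective T.range_rangeRestrict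
    refine ⟨L.comp s, fun x => ?_⟩
    rw [LinearMap.comp_apply, ← sub_eq_zero, ← map_sub, ← LinearMap.mem_ker]
    apply hker
    rw [LinearMap.mem_ker, map_sub, sub_eq_zero]
    exact LinearMap.congr_fun hs _
  obtain ⟨G, hG, hGn⟩ := exists_extension_norm_eq (LinearMap.range T)
    (ℓ.mkContinuous (Real.sqrt t) (by
      rintro ⟨_, x, rfl⟩
      have := hℓ x
      change ‖ℓ (T.rangeRestrict x)‖ ≤ _
      rw [this]; exact hb x))
  have hn : ‖G‖ ≤ Real.sqrt t := by
    rw [hGn]; exact LinearMap.mkContinuous_norm_le _ (by positivity) _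
  set g := (InnerProductSpace.toDual ℂ (lp (fun _ : ℕ => ℂ) 2)).symm G with hg
  obtain ⟨h1, h2⟩ := memH2_of_l2 (f := F) g (by
    intro z hz
    have e1 : inner ℂ g (kv z) = G (kv z) := InnerProductSpace.toDual_symm_apply
    have e2 : T (Finsupp.single ⟨z, hz⟩ 1) = kv z := by simp [T]
    have e3 := hG (T.rangeRestrict (Finsupp.single ⟨z, hz⟩ 1))
    rw [LinearMap.mkContinuous_apply, hℓ] at e3
    have e4 : G (kv z) = (starRingEnd ℂ) (F z) := by
      rw [← e2]; refine e3.trans ?_; simp [L]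
    rw [← inner_conj_symm, e1, e4, Complex.conj_conj])
  refine ⟨h1, ?_⟩
  rw [h2, hg, LinearIsometryEquiv.norm_map]
  calc ‖G‖ ^ 2 ≤ Real.sqrt t ^ 2 := by gcongr
    _ = t := Real.sq_sqrt ht

lemma wcomp_bdd {φ u f : ℂ → ℂ} {t : ℝ} (hφ : MemBallHinf φ)
    (hφmap : ∀ z ∈ unitDisk, φ z ∈ unitDisk) (hu : HbRKBound φ u t) (hf : MemH2 f) :
    MemH2 (fun z => u z * f (φ z)) ∧
      h2NormSq (fun z => u z * f (φ z)) ≤ max t 0 * h2NormSq f := by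
  have hN : 0 ≤ h2NormSq f := tsum_nonneg fun _ => by positivity
  apply riesz_rep (mul_nonneg (le_max_right _ _) hN)
  intro k lam α hl
  have hl' : ∀ i, ‖lam i‖ < 1 := fun i => mem_unitDisk.1 (hl i)
  have hp : ∀ i, ‖φ (lam i)‖ < 1 := fun i => mem_unitDisk.1 (hφmap _ (hl i))
  set A : ℕ → ℂ := fun n => ∑ i, (starRingEnd ℂ) (α i) * (u (lam i) * φ (lam i) ^ n) with hA
  have hsum : HasSum (fun n => taylorCoeff f n * A n)
      (∑ i, (starRingEnd ℂ) (α i) * (u (lam i) * f (φ (lam i)))) := by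
    have : ∀ i ∈ Finset.univ, HasSum (fun n => (starRingEnd ℂ) (α i) * (u (lam i) *
        (taylorCoeff f n * φ (lam i) ^ n))) 
        ((starRingEnd ℂ) (α i) * (u (lam i) * f (φ (lam i)))) := fun i _ =>
      ((hasSum_taylorCoeff hf.1 (hφmap _ (hl i))).mul_left _).mul_left _
    refine (hasSum_sum this).congr_fun fun n => ?_
    rw [hA]
    simp only [Finset.mul_sum]
    refine Finset.sum_congr rfl fun i _ => by ring
  set Q : ℕ → ℝ := fun n => (∑ i, ∑ j, (α i * (starRingEnd ℂ) (φ (lam i)) ^ n) *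
    (starRingEnd ℂ) (α j * (starRingEnd ℂ) (φ (lam j)) ^ n) * rkKernel φ (lam i) (lam j)).re with hQ
  have hQ0 : ∀ n, 0 ≤ Q n := fun n => rk_pos hφ k lam _ hl
  have hAQ : ∀ n, ‖A n‖ ^ 2 ≤ max t 0 * Q n := by
    intro n
    have h1 := hu k lam (fun i => α i * (starRingEnd ℂ) (φ (lam i)) ^ n) hl
    have e : ∑ i, (starRingEnd ℂ) (α i * (starRingEnd ℂ) (φ (lam i)) ^ n) * u (lam i) = A n := by
      refine Finset.sum_congr rfl fun i _ => ?_
      simp only [map_mul, map_pow, Complex.conj_conj]; ring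
    rw [e] at h1
    exact h1.trans (mul_le_mul_of_nonneg_right (le_max_left _ _) (hQ0 n))
  have hQs : HasSum Q (‖∑ i, α i • kv (lam i)‖ ^ 2) := by
    have h1 : ∀ i ∈ Finset.univ, HasSum (fun n => ∑ j, (α i * (starRingEnd ℂ) (φ (lam i)) ^ n) *
        (starRingEnd ℂ) (α j * (starRingEnd ℂ) (φ (lam j)) ^ n) * rkKernel φ (lam i) (lam j))
        (∑ j, α i * (starRingEnd ℂ) (α j) * (1 / (1 - (starRingEnd ℂ) (lam i) * lam j))) := by
      intro i _
      apply hasSum_sum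
      intro j _
      have hlt : ‖(starRingEnd ℂ) (φ (lam i)) * φ (lam j)‖ < 1 := by
        rw [norm_mul, RCLike.norm_conj]
        nlinarith [hp i, hp j, norm_nonneg (φ (lam i)), norm_nonneg (φ (lam j))]
      have h2 := (hasSum_geometric_of_norm_lt_one hlt).mul_left
        (α i * (starRingEnd ℂ) (α j) * rkKernel φ (lam i) (lam j))
      have hne : 1 - (starRingEnd ℂ) (φ (lam i)) * φ (lam j) ≠ 0 := by
        intro h0
        rw [sub_eq_zero] at h0
        rw [← h0] at hlt; simp at hlt
      have e : α i * (starRingEnd ℂ) (α j) * (1 / (1 - (starRingEnd ℂ) (lam i) * lam j)) =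
          α i * (starRingEnd ℂ) (α j) * rkKernel φ (lam i) (lam j) * 
            (1 - (starRingEnd ℂ) (φ (lam i)) * φ (lam j))⁻¹ := by
        rw [rkKernel]; field_simp
      rw [e]
      refine h2.congr_fun fun n => ?_
      simp only [map_mul, map_pow, Complex.conj_conj]; ring
    have h3 := hasSum_sum h1
    have h4 := Complex.hasSum_re h3
    have e : ‖∑ i, α i • kv (lam i)‖ ^ 2 = (∑ i, ∑ j, α i * (starRingEnd ℂ) (α j) *
        (1 / (1 - (starRingEnd ℂ) (lam i) * lam j))).re := by
      have h6 : ∀ h : lp (fun _ : ℕ => ℂ) 2, ‖h‖ ^ 2 = (inner ℂ h h).re := by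
        intro h
        rw [inner_self_eq_norm_sq_to_K]; norm_cast
      rw [h6]
      simp only [sum_inner, inner_sum, inner_smul_left, inner_smul_right, Finset.mul_sum]
      congr 1
      refine Finset.sum_congr rfl fun i _ => Finset.sum_congr rfl fun j _ => ?_
      rw [kv_inner_kv (hl' i) (hl' j)]; ring
    rw [e]; exact h4
  have hAs : Summable fun n => ‖A n‖ ^ 2 :=
    Summable.of_nonneg_of_le (fun _ => by positivity) hAQ (hQs.summable.mul_left _)
  have hAle : ∑' n, ‖A n‖ ^ 2 ≤ max t 0 * ‖∑ i, α i • kv (lam i)‖ ^ 2 := by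
    rw [← hQs.tsum_eq, ← tsum_mul_left]
    exact hAs.tsum_le_tsum hAQ (hQs.summable.mul_left _)
  let a : lp (fun _ : ℕ => ℂ) 2 := ⟨fun n => (starRingEnd ℂ) (A n), by
    apply memℓp_gen; simpa using hAs⟩
  have ha : ‖a‖ ^ 2 = ∑' n, ‖A n‖ ^ 2 := by
    have h2 : HasSum (fun n => ‖A n‖ ^ 2) (‖a‖ ^ 2) := by
      simpa [a] using lp.hasSum_norm (p := 2) (by norm_num) a
    exact h2.tsum_eq.symm
  have hin : inner ℂ a (toL2 f hf) = ∑ i, (starRingEnd ℂ) (α i) * (u (lam i) * f (φ (lam i))) := by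
    refine (lp.hasSum_inner (𝕜 := ℂ) a (toL2 f hf)).unique (hsum.congr_fun fun n => ?_)
    simp [a, toL2]
  rw [← hin]
  calc ‖inner ℂ a (toL2 f hf)‖ ^ 2 ≤ (‖a‖ * ‖toL2 f hf‖) ^ 2 := by
        gcongr; exact norm_inner_le_norm _ _
    _ = (∑' n, ‖A n‖ ^ 2) * h2NormSq f := by rw [mul_pow, ha, toL2_norm]
    _ ≤ (max t 0 * ‖∑ i, α i • kv (lam i)‖ ^ 2) * h2NormSq f := by gcongr
    _ = _ := by ring

/-- The boundary kernel belongs to `H(φ)` if the difference quotient is radially bounded. -/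
lemma memHbRK_of_kernel {φ u : ℂ → ℂ} {K : ℝ} (hφ : MemBallHinf φ)
    (hφmap : ∀ z ∈ unitDisk, φ z ∈ unitDisk) 
    (hφ1 : Tendsto (fun r : ℝ => φ r) (nhdsWithin 1 (Iio 1)) (nhds 1))
    (hu : u = fun z => (φ z - 1) / (z - 1))
    (hK : ∀ᶠ r : ℝ in nhdsWithin 1 (Iio 1), (1 - ‖φ r‖ ^ 2) ≤ K * (1 - r ^ 2)) :
    HbRKBound φ u K := by
  intro k lam α hl
  have hl' : ∀ i, ‖lam i‖ < 1 := fun i => mem_unitDisk.1 (hl i)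
  set B := (∑ i, ∑ j, α i * (starRingEnd ℂ) (α j) * rkKernel φ (lam i) (lam j)).re with hB
  have hB0 : 0 ≤ B := rk_pos hφ k lam α hl
  have key : ∀ᶠ r : ℝ in nhdsWithin 1 (Iio 1),
      ‖∑ i, (starRingEnd ℂ) (α i) * rkKernel φ r (lam i)‖ ^ 2 ≤ K * B := by
    filter_upwards [hK, Ioo_mem_nhdsLT (show (0:ℝ) < 1 by norm_num)] with r hr hr01
    have hrD : (r : ℂ) ∈ unitDisk := by simp [mem_unitDisk, abs_of_pos hr01.1, hr01.2]
    set X := ∑ i, (starRingEnd ℂ) (α i) * rkKernel φ r (lam i) with hX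
    set A : ℝ := (1 - ‖φ r‖ ^ 2) / (1 - r ^ 2) with hA
    have hpr : ‖φ r‖ < 1 := mem_unitDisk.1 (hφmap _ hrD)
    have hr2 : 0 < 1 - r ^ 2 := by nlinarith [hr01.1, hr01.2]
    have hA0 : 0 < A := by
      apply div_pos _ hr2; nlinarith [norm_nonneg (φ r)]
    have hAk : rkKernel φ r r = (A : ℂ) := by
      rw [rkKernel, hA, mul_comm, Complex.mul_conj, Complex.normSq_eq_norm_sq, Complex.conj_ofReal]
      push_cast; ring
    have hconj : ∀ l z, rkKernel φ l z = (starRingEnd ℂ) (rkKernel φ z l) := by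
      intro l z; simp only [rkKernel, map_div₀, map_sub, map_mul, map_one, Complex.conj_conj]
      ring
    have hpos : ∀ β : ℂ, 0 ≤ ‖β‖ ^ 2 * A + 2 * (β * X).re + B := by
      intro β
      have h1 := rk_pos hφ (k + 1) (Fin.cons (r : ℂ) lam) (Fin.cons β α) (by
        intro i; refine Fin.cases ?_ (fun i => ?_) i
        · simpa using hrD
        · simpa using hl i)
      simp only [Fin.sum_univ_succ, Fin.cons_zero, Fin.cons_succ, Finset.sum_add_distrib] at h1
      have e1 : (β * (starRingEnd ℂ) β * rkKernel φ r r).re = ‖β‖ ^ 2 * A := by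
        rw [hAk, Complex.mul_conj, Complex.normSq_eq_norm_sq]; norm_cast
      have e2 : ∑ j, β * (starRingEnd ℂ) (α j) * rkKernel φ r (lam j) = β * X := by
        rw [hX, Finset.mul_sum]; exact Finset.sum_congr rfl fun _ _ => by ring
      have e3 : ∑ j, α j * (starRingEnd ℂ) β * rkKernel φ (lam j) r = (starRingEnd ℂ) (β * X) := by
        rw [← e2, map_sum]
        refine Finset.sum_congr rfl fun j _ => ?_
        rw [hconj (lam j) r]; simp only [map_mul, Complex.conj_conj]; ring
      rw [e2, e3, Complex.add_re, Complex.add_re, Complex.add_re, e1, Complex.conj_re, ← hB] at h1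
      linarith
    have hXA : ‖X‖ ^ 2 ≤ A * B := by
      have h1 := hpos (-(starRingEnd ℂ) X / A)
      have e1 : ‖-(starRingEnd ℂ) X / (A : ℂ)‖ ^ 2 * A = ‖X‖ ^ 2 / A := by
        rw [norm_div, norm_neg, RCLike.norm_conj, Complex.norm_real, Real.norm_of_nonneg hA0.le]
        field_simp
      have e2 : (-(starRingEnd ℂ) X / (A : ℂ) * X).re = - (‖X‖ ^ 2 / A) := by
        have : -(starRingEnd ℂ) X / (A : ℂ) * X = ((- (‖X‖ ^ 2 / A) : ℝ) : ℂ) := by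
          rw [show -(starRingEnd ℂ) X / (A : ℂ) * X = -(X * (starRingEnd ℂ) X) / A by ring,
            Complex.mul_conj, Complex.normSq_eq_norm_sq]
          push_cast; ring
        rw [this, Complex.ofReal_re]
      rw [e1, e2] at h1
      have h2 : ‖X‖ ^ 2 / A ≤ B := by linarith
      rw [div_le_iff₀ hA0] at h2; linarith
    refine hXA.trans (mul_le_mul_of_nonneg_right ?_ hB0)
    rw [hA, div_le_iff₀ hr2]
    exact hr
  have hlim : Tendsto (fun r : ℝ => ‖∑ i, (starRingEnd ℂ) (α i) * rkKernel φ r (lam i)‖ ^ 2)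
      (nhdsWithin 1 (Iio 1)) (nhds (‖∑ i, (starRingEnd ℂ) (α i) * u (lam i)‖ ^ 2)) := by
    refine ((tendsto_finsetSum _ fun i _ => ?_).norm).pow 2
    refine Tendsto.const_mul _ ?_
    have hne : 1 - lam i ≠ 0 := by
      intro h0
      have := hl' i
      rw [sub_eq_zero] at h0; rw [← h0] at this; simp at this
    have e : u (lam i) = (1 - (starRingEnd ℂ) 1 * φ (lam i)) / (1 - (starRingEnd ℂ) ((1 : ℝ) : ℂ) * lam i) := by
      have h1 : lam i - 1 ≠ 0 := fun h => hne (by linear_combination -h)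
      simp only [hu, map_one, one_mul, Complex.ofReal_one]
      rw [div_eq_div_iff h1 hne]; ring
    rw [e]
    unfold rkKernel
    refine Tendsto.div ?_ ?_ (by simpa using hne)
    · exact tendsto_const_nhds.sub (((Complex.continuous_conj.tendsto 1).comp hφ1).mul_const _)
    · refine tendsto_const_nhds.sub (Tendsto.mul_const _ ?_)
      exact ((Complex.continuous_conj.comp Complex.continuous_ofReal).tendsto 1).mono_left nhdsWithin_le_nhds
  exact le_of_tendsto hlim key

lemma memHbRK_of_radial {φ u : ℂ → ℂ} {K : ℝ} (hφ : MemBallHinf φ)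
    (hφmap : ∀ z ∈ unitDisk, φ z ∈ unitDisk) 
    (hφ1 : Tendsto (fun r : ℝ => φ r) (nhdsWithin 1 (Iio 1)) (nhds 1))
    (hu : u = fun z => (φ z - 1) / (z - 1))
    (hK : ∀ᶠ r : ℝ in nhdsWithin 1 (Iio 1), ‖u r‖ ≤ K) : HbRKBound φ u (2 * K) := by
  refine memHbRK_of_kernel hφ hφmap hφ1 hu ?_
  filter_upwards [hK, Ioo_mem_nhdsLT (show (0:ℝ) < 1 by norm_num)] with r hr hr01
  have hrD : (r : ℂ) ∈ unitDisk := by simp [mem_unitDisk, abs_of_pos hr01.1, hr01.2]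
  have hpr : ‖φ r‖ < 1 := mem_unitDisk.1 (hφmap _ hrD)
  have h3 : ‖φ r - 1‖ ≤ K * (1 - r) := by
    have e : ‖u r‖ * (1 - r) = ‖φ r - 1‖ := by
      rw [hu]
      simp only [norm_div]
      have : ‖(r : ℂ) - 1‖ = 1 - r := by
        rw [← Complex.ofReal_one, ← Complex.ofReal_sub, Complex.norm_real, Real.norm_eq_abs,
          abs_sub_comm, abs_of_pos (by linarith [hr01.2])]
      rw [this]
      have : 1 - r ≠ 0 := by linarith [hr01.2]
      field_simp
    rw [← e]
    exact mul_le_mul_of_nonneg_right hr (by linarith [hr01.2])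
  have h4 : 1 - ‖φ r‖ ≤ ‖φ r - 1‖ := by
    have := norm_sub_norm_le (1 : ℂ) (φ r)
    rw [norm_one, norm_sub_rev] at this; exact this
  have hK0 : 0 ≤ K := (norm_nonneg _).trans hr
  nlinarith [norm_nonneg (φ r), mul_nonneg hK0 (mul_nonneg hr01.1.le (show 0 ≤ 1 - r by linarith [hr01.2]))]

lemma radial_stolz : Tendsto (fun r : ℝ => (r : ℂ)) (nhdsWithin 1 (Iio 1))
    (nhdsWithin (1 : ℂ) (stolzAngle 1 2)) := by
  apply tendsto_nhdsWithin_of_tendsto_nhds_of_eventually_within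
  · have := (Complex.continuous_ofReal.tendsto 1).mono_left (nhdsWithin_le_nhds (s := Iio (1:ℝ)))
    simpa using this
  · filter_upwards [Ioo_mem_nhdsLT (show (0:ℝ) < 1 by norm_num)] with r hr
    refine ⟨by simp [mem_unitDisk, abs_of_pos hr.1, hr.2], ?_⟩
    rw [← Complex.ofReal_one, ← Complex.ofReal_sub, Complex.norm_real, Complex.norm_real,
      Real.norm_eq_abs, Real.norm_eq_abs, abs_of_pos hr.1, abs_sub_comm,
      abs_of_pos (by linarith [hr.2])]
    linarith [hr.2]

lemma taylorCoeff_congr {f g : ℂ → ℂ} (hf : MemH2 f) (h : ∀ z ∈ unitDisk, f z = g z) :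
    ∀ n, taylorCoeff g n = taylorCoeff f n :=
  (taylor_of_hasSum (a := taylorCoeff f) (f := g) (fun z hz => by
    rw [← h z hz]; exact hasSum_taylorCoeff hf.1 hz)).2

lemma memH2_congr {f g : ℂ → ℂ} (hf : MemH2 f) (h : ∀ z ∈ unitDisk, f z = g z) :
    MemH2 g ∧ h2NormSq g = h2NormSq f := by
  have e := taylorCoeff_congr hf h
  refine ⟨⟨hf.1.congr fun z hz => (h z hz).symm, ?_⟩, ?_⟩
  · simpa [e] using hf.2
  · simp [h2NormSq, e]

lemma h2NormSq_const (c : ℂ) : h2NormSq (fun _ => c) = ‖c‖ ^ 2 := by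
  have h := (taylor_of_hasSum (a := fun n => if n = 0 then c else 0) (f := fun _ => c) (fun z _ => by
    have := hasSum_single (f := fun n : ℕ => (if n = 0 then c else 0) * z ^ n) 0 (by
      intro n hn; simp [hn])
    simpa using this)).2
  rw [h2NormSq, tsum_eq_single 0]
  · simp [h]
  · intro n hn; simp [h, hn]

lemma tendsto_sub_one_mul {g : ℂ → ℂ} (hg : MemH2 g) :
    Tendsto (fun r : ℝ => ((r : ℂ) - 1) * g r) (nhdsWithin 1 (Iio 1)) (nhds 0) := by
  rw [tendsto_zero_iff_norm_tendsto_zero]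
  have h2 : Tendsto (fun r : ℝ => Real.sqrt ((1 - r) * h2NormSq g)) (nhdsWithin 1 (Iio 1)) (nhds 0) := by
    have : Continuous fun r : ℝ => Real.sqrt ((1 - r) * h2NormSq g) := by fun_prop
    have := (this.tendsto 1).mono_left (nhdsWithin_le_nhds (s := Iio (1:ℝ)))
    simpa using this
  refine squeeze_zero' (Eventually.of_forall fun _ => norm_nonneg _) ?_ h2
  filter_upwards [Ioo_mem_nhdsLT (show (0:ℝ) < 1 by norm_num)] with r hr
  apply Real.le_sqrt_of_sq_le
  have hn : ‖(r : ℂ)‖ = r := by simp [abs_of_pos hr.1]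
  have h1 := h2_point hg (z := r) (by rw [hn]; exact hr.2)
  rw [hn] at h1
  have : ‖(r : ℂ) - 1‖ = 1 - r := by
    rw [← Complex.ofReal_one, ← Complex.ofReal_sub, Complex.norm_real, Real.norm_eq_abs,
      abs_sub_comm, abs_of_pos (by linarith [hr.2])]
  rw [norm_mul, this, mul_pow]
  have h3 : 0 ≤ 1 - r := by linarith [hr.2]
  have h4 : (1 - r) * (‖g r‖ ^ 2 * (1 - r ^ 2)) ≤ (1 - r) * h2NormSq g := by gcongr
  nlinarith [mul_nonneg (mul_nonneg (mul_nonneg h3 h3) hr.1.le) (sq_nonneg ‖g r‖)]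

lemma hb_unique {g₁ g₂ : ℂ → ℂ} {c₁ c₂ : ℂ} (h₁ : MemH2 g₁) (h₂ : MemH2 g₂)
    (h : ∀ z ∈ unitDisk, (z - 1) * g₁ z + c₁ = (z - 1) * g₂ z + c₂) :
    c₁ = c₂ ∧ ∀ z ∈ unitDisk, g₁ z = g₂ z := by
  have hc : c₁ = c₂ := by
    have t1 := (tendsto_sub_one_mul h₁).add_const c₁
    have t2 := (tendsto_sub_one_mul h₂).add_const c₂
    have t3 := t1.congr' (f₂ := fun r : ℝ => ((r : ℂ) - 1) * g₂ r + c₂) (by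
      filter_upwards [Ioo_mem_nhdsLT (show (0:ℝ) < 1 by norm_num)] with r hr
      exact h _ (by simp [mem_unitDisk, abs_of_pos hr.1, hr.2]))
    simpa using tendsto_nhds_unique t3 t2
  refine ⟨hc, fun z hz => ?_⟩
  have h1 := h z hz
  have hne : z - 1 ≠ 0 := by
    intro h0
    rw [mem_unitDisk, sub_eq_zero.1 h0] at hz; simp at hz
  rw [hc] at h1
  exact mul_left_cancel₀ hne (add_right_cancel h1)

lemma hbDecompOf_iff {f g : ℂ → ℂ} {q : Polynomial ℂ} :
    HbDecompOf (fun _ : Fin 1 => (1:ℂ)) (fun _ => 1) f g q ↔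
      MemH2 g ∧ q = Polynomial.C (q.coeff 0) ∧ ∀ z ∈ unitDisk, f z = (z - 1) * g z + q.coeff 0 := by
  unfold HbDecompOf a1fun
  have e : q.degree < ((∑ j : Fin 1, 1 : ℕ) : WithBot ℕ) ↔ q = Polynomial.C (q.coeff 0) := by
    constructor
    · intro h
      apply Polynomial.eq_C_of_degree_le_zero
      rw [← Polynomial.natDegree_eq_zero_iff_degree_le_zero]
      by_cases hq : q = 0
      · simp [hq]
      · have := (Polynomial.natDegree_lt_iff_degree_lt hq).2 h
        simpa using this
    · intro h
      rw [h]
      refine lt_of_le_of_lt Polynomial.degree_C_le ?_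
      simp
  rw [e]
  refine and_congr_right fun _ => and_congr_right fun hq => ?_
  have : ∀ z, q.eval z = q.coeff 0 := by intro z; rw [hq]; simp
  simp [this]

lemma hb_of {f g : ℂ → ℂ} {c : ℂ} (hg : MemH2 g)
    (h : ∀ z ∈ unitDisk, f z = (z - 1) * g z + c) :
    MemHb (fun _ : Fin 1 => (1:ℂ)) (fun _ => 1) f ∧
    hbNormSq (fun _ : Fin 1 => (1:ℂ)) (fun _ => 1) f = h2NormSq g + ‖c‖ ^ 2 := by
  have hm : MemHb (fun _ : Fin 1 => (1:ℂ)) (fun _ => 1) f :=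
    ⟨(g, Polynomial.C c), hbDecompOf_iff.2 ⟨hg, by simp, by simpa using h⟩⟩
  refine ⟨hm, ?_⟩
  obtain ⟨h1, h2, h3⟩ := hbDecompOf_iff.1 hm.choose_spec
  obtain ⟨h4, h5⟩ := hb_unique hg h1 (fun z hz => (h z hz).symm.trans (h3 z hz))
  rw [hbNormSq, hbDecomp, dif_pos hm, (memH2_congr hg h5).2]
  congr 1
  have : ∀ z, hm.choose.2.eval z = hm.choose.2.coeff 0 := by intro z; rw [h2]; simp
  simp only [this]
  rw [h2NormSq_const, h4]

lemma memHb_elim {f : ℂ → ℂ} (h : MemHb (fun _ : Fin 1 => (1:ℂ)) (fun _ => 1) f) :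
    ∃ g c, MemH2 g ∧ ∀ z ∈ unitDisk, f z = (z - 1) * g z + c := by
  obtain ⟨⟨g, q⟩, hgq⟩ := h
  obtain ⟨h1, _, h3⟩ := hbDecompOf_iff.1 hgq
  exact ⟨g, _, h1, h3⟩

lemma sub_one_ne {z : ℂ} (hz : z ∈ unitDisk) : z - 1 ≠ 0 := by
  intro h0
  rw [mem_unitDisk, sub_eq_zero.1 h0] at hz; simp at hz

lemma u_memH2 {φ u : ℂ → ℂ} (hφb : MemHb (fun _ : Fin 1 => (1:ℂ)) (fun _ => 1) φ)
    (hφ1 : Tendsto (fun r : ℝ => φ r) (nhdsWithin 1 (Iio 1)) (nhds 1))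
    (hu : u = fun z => (φ z - 1) / (z - 1)) : MemH2 u := by
  obtain ⟨g, c, hg, h⟩ := memHb_elim hφb
  have hc : c = 1 := by
    have t1 := (tendsto_sub_one_mul hg).add_const c
    have t3 := t1.congr' (f₂ := fun r : ℝ => φ r) (by
      filter_upwards [Ioo_mem_nhdsLT (show (0:ℝ) < 1 by norm_num)] with r hr
      exact (h _ (by simp [mem_unitDisk, abs_of_pos hr.1, hr.2])).symm)
    simpa using tendsto_nhds_unique t3 hφ1
  refine (memH2_congr hg fun z hz => ?_).1
  have := sub_one_ne hz
  rw [hu]; simp only [h z hz, hc]; field_simp; ring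

lemma comp_of_rk {φ u : ℂ → ℂ} (hφ : MemBallHinf φ)
    (hφmap : ∀ z ∈ unitDisk, φ z ∈ unitDisk)
    (hu : u = fun z => (φ z - 1) / (z - 1)) (h : MemHbRK φ u) :
    CompBddHb (fun _ : Fin 1 => (1:ℂ)) (fun _ => 1) φ := by
  obtain ⟨t, ht⟩ := h
  have key : ∀ g c, ∀ f : ℂ → ℂ, MemH2 g → (∀ z ∈ unitDisk, f z = (z - 1) * g z + c) →
      ∀ z ∈ unitDisk, f (φ z) = (z - 1) * (u z * g (φ z)) + c := by
    intro g c f _ hf z hz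
    rw [hf _ (hφmap z hz), hu]
    have := sub_one_ne hz
    simp only; field_simp
  refine ⟨fun f hf => ?_, max (max t 0) 1, fun f hf => ?_⟩
  · obtain ⟨g, c, hg, hf⟩ := memHb_elim hf
    exact (hb_of (wcomp_bdd hφ hφmap ht hg).1 (key g c f hg hf)).1
  · obtain ⟨g, c, hg, hf⟩ := memHb_elim hf
    have hw := wcomp_bdd hφ hφmap ht hg
    rw [(hb_of hg hf).2, (hb_of hw.1 (key g c f hg hf)).2, mul_add]
    have hN : 0 ≤ h2NormSq g := tsum_nonneg fun _ => by positivity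
    refine add_le_add (hw.2.trans ?_) ?_
    · exact mul_le_mul_of_nonneg_right (le_max_left _ _) hN
    · exact le_mul_of_one_le_left (by positivity) (le_max_right _ _)

lemma radial_of_ineq {φ u : ℂ → ℂ} (hφ : ∀ z ∈ unitDisk, φ z ∈ unitDisk)
    (hu : u = fun z => (φ z - 1) / (z - 1)) {C : ℝ}
    (h : ∀ z ∈ unitDisk, ‖u z‖ ^ 2 * (1 - ‖z‖ ^ 2) ≤ C * (1 - ‖φ z‖ ^ 2)) :
    ∀ᶠ r : ℝ in nhdsWithin 1 (Iio 1), ‖u r‖ ≤ 2 * max C 0 := by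
  filter_upwards [Ioo_mem_nhdsLT (show (0:ℝ) < 1 by norm_num)] with r hr01
  have hrD : (r : ℂ) ∈ unitDisk := by simp [mem_unitDisk, abs_of_pos hr01.1, hr01.2]
  have hn : ‖(r : ℂ)‖ = r := by simp [abs_of_pos hr01.1]
  have e : ‖u r‖ * (1 - r) = ‖φ r - 1‖ := by
    rw [hu]
    simp only [norm_div]
    have : ‖(r : ℂ) - 1‖ = 1 - r := by
      rw [← Complex.ofReal_one, ← Complex.ofReal_sub, Complex.norm_real, Real.norm_eq_abs,
        abs_sub_comm, abs_of_pos (by linarith [hr01.2])]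
    rw [this]
    have : 1 - r ≠ 0 := by linarith [hr01.2]
    field_simp
  have h4 : 1 - ‖φ r‖ ≤ ‖φ r - 1‖ := by
    have := norm_sub_norm_le (1 : ℂ) (φ r)
    rw [norm_one, norm_sub_rev] at this; exact this
  have hp : ‖φ r‖ < 1 := mem_unitDisk.1 (hφ _ hrD)
  have h1 := h r hrD
  rw [hn] at h1
  set x := ‖u r‖
  have hx : 0 ≤ x := norm_nonneg _
  set D := max C 0
  have hD : 0 ≤ D := le_max_right _ _
  have h5 : 1 - ‖φ r‖ ^ 2 ≤ 2 * (x * (1 - r)) := by rw [e]; nlinarith [norm_nonneg (φ r)]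
  have h6 : x ^ 2 * (1 - r ^ 2) ≤ D * (2 * (x * (1 - r))) := by
    refine h1.trans ((mul_le_mul_of_nonneg_right (le_max_left C 0) ?_).trans ?_)
    · nlinarith [norm_nonneg (φ r)]
    · gcongr
  have h7 : x ^ 2 * (1 + r) ≤ 2 * D * x := by
    have h1r : 0 < 1 - r := by linarith [hr01.2]
    refine le_of_mul_le_mul_right ?_ h1r
    nlinarith
  by_contra hcon
  push Not at hcon
  nlinarith [mul_nonneg (sq_nonneg x) hr01.1.le]

lemma radial_of_rk {φ u : ℂ → ℂ} (hφ : ∀ z ∈ unitDisk, φ z ∈ unitDisk)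
    (hu : u = fun z => (φ z - 1) / (z - 1)) (h : MemHbRK φ u) :
    ∃ K : ℝ, ∀ᶠ r : ℝ in nhdsWithin 1 (Iio 1), ‖u r‖ ≤ K := by
  obtain ⟨t, ht⟩ := h
  refine ⟨_, radial_of_ineq hφ hu (C := t) fun z hz => ?_⟩
  have h1 := ht 1 (fun _ => z) (fun _ => 1) (fun _ => hz)
  have e : (rkKernel φ z z).re = (1 - ‖φ z‖ ^ 2) / (1 - ‖z‖ ^ 2) := by
    rw [rkKernel, mul_comm, Complex.mul_conj, mul_comm, Complex.mul_conj, 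
      Complex.normSq_eq_norm_sq, Complex.normSq_eq_norm_sq]
    norm_cast
  have hz2 : 0 < 1 - ‖z‖ ^ 2 := by nlinarith [mem_unitDisk.1 hz, norm_nonneg z]
  simp only [Finset.univ_unique, Finset.sum_const, Finset.card_singleton, one_smul, map_one,
    one_mul, e] at h1
  rwa [mul_div_assoc', le_div_iff₀ hz2] at h1

lemma radial_of_comp {φ u : ℂ → ℂ} (hφb : MemHb (fun _ : Fin 1 => (1:ℂ)) (fun _ => 1) φ)
    (hφd : DifferentiableOn ℂ φ unitDisk) (hφ : ∀ z ∈ unitDisk, φ z ∈ unitDisk)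
    (hφ1 : Tendsto (fun r : ℝ => φ r) (nhdsWithin 1 (Iio 1)) (nhds 1))
    (hu : u = fun z => (φ z - 1) / (z - 1))
    (h : CompBddHb (fun _ : Fin 1 => (1:ℂ)) (fun _ => 1) φ) :
    ∃ K : ℝ, ∀ᶠ r : ℝ in nhdsWithin 1 (Iio 1), ‖u r‖ ≤ K := by
  obtain ⟨_, C, hC⟩ := h
  have huH := u_memH2 hφb hφ1 hu
  refine ⟨_, radial_of_ineq hφ hu (C := C) fun z hz => ?_⟩
  set w := φ z with hw
  have hwD : ‖w‖ < 1 := mem_unitDisk.1 (hφ z hz)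
  set k : ℂ → ℂ := fun y => inner ℂ (kv y) (kv w) with hk
  obtain ⟨hk1, hk2⟩ := memH2_of_l2 (f := k) (kv w) (fun _ _ => rfl)
  have hkb : ∀ y ∈ unitDisk, ‖k (φ y)‖ ≤ (1 - ‖w‖)⁻¹ := by
    intro y hy
    have hpy := mem_unitDisk.1 (hφ y hy)
    rw [hk]; simp only
    rw [kv_inner_kv hwD hpy, norm_div, norm_one, one_div]
    apply inv_anti₀ (by linarith)
    have h1 := norm_sub_norm_le (1 : ℂ) ((starRingEnd ℂ) w * φ y)
    rw [norm_one, norm_mul, RCLike.norm_conj] at h1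
    nlinarith [norm_nonneg w, norm_nonneg (φ y)]
  obtain ⟨hm, _⟩ := memH2_mul (m := fun y => k (φ y)) (hk1.1.comp hφd hφ)
    (by have : 0 < 1 - ‖w‖ := by linarith
        positivity) hkb huH
  obtain ⟨hf1, hf2⟩ := hb_of (f := fun y => (y - 1) * k y) (c := 0) hk1 (fun _ _ => by simp)
  have hF := hb_of (f := fun y => (fun y => (y - 1) * k y) (φ y)) (c := 0) hm (by
    intro y hy
    have := sub_one_ne hy
    simp only [hu]; field_simp; ring)
  have h1 := hC _ hf1
  rw [hF.2, hf2, hk2, kv_norm_sq hwD] at h1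
  have h2 := h2_point hm (mem_unitDisk.1 hz)
  have hw2 : 0 < 1 - ‖w‖ ^ 2 := by nlinarith [norm_nonneg w]
  have e : ‖k (φ z)‖ = 1 / (1 - ‖w‖ ^ 2) := by
    rw [← kv_norm_sq hwD, hk, ← hw]
    simp only
    rw [inner_self_eq_norm_sq_to_K]; simp
  rw [norm_mul, e] at h2
  simp only [norm_zero, ne_eq, OfNat.ofNat_ne_zero, not_false_eq_true, zero_pow, add_zero] at h1
  have h3 := h2.trans h1
  have e4 : (1 / (1 - ‖w‖ ^ 2) * ‖u z‖) ^ 2 * (1 - ‖z‖ ^ 2) = 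
    (‖u z‖ ^ 2 * (1 - ‖z‖ ^ 2)) / (1 - ‖w‖ ^ 2) ^ 2 := by
    have := hw2.ne'
    field_simp
  rw [e4, div_le_iff₀ (by positivity)] at h3
  refine h3.trans (le_of_eq ?_)
  field_simp

lemma u_mul {φ u : ℂ → ℂ} (hu : u = fun z => (φ z - 1) / (z - 1)) {z : ℂ} (hz : z ∈ unitDisk) :
    u z * (z - 1) = φ z - 1 := by
  rw [hu]; exact div_mul_cancel₀ _ (sub_one_ne hz)

lemma one_sub_le {φ u : ℂ → ℂ} (hφ : ∀ z ∈ unitDisk, φ z ∈ unitDisk)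
    (hu : u = fun z => (φ z - 1) / (z - 1)) {z : ℂ} (hz : z ∈ unitDisk) :
    1 - ‖φ z‖ ^ 2 ≤ 2 * (‖u z‖ * ‖z - 1‖) := by
  rw [← norm_mul, u_mul hu hz]
  have h4 : 1 - ‖φ z‖ ≤ ‖φ z - 1‖ := by
    have := norm_sub_norm_le (1 : ℂ) (φ z)
    rw [norm_one, norm_sub_rev] at this; exact this
  have hp : ‖φ z‖ < 1 := mem_unitDisk.1 (hφ _ hz)
  nlinarith [norm_nonneg (φ z)]

lemma rk_of_ineq {φ u : ℂ → ℂ} (hφ : MemBallHinf φ)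
    (hφmap : ∀ z ∈ unitDisk, φ z ∈ unitDisk)
    (hφ1 : Tendsto (fun r : ℝ => φ r) (nhdsWithin 1 (Iio 1)) (nhds 1))
    (hu : u = fun z => (φ z - 1) / (z - 1)) {C : ℝ} (hC0 : 0 ≤ C)
    (h : ∀ z ∈ unitDisk, ‖u z‖ ^ 2 * (1 - ‖z‖ ^ 2) ≤ C * (1 - ‖φ z‖ ^ 2)) :
    HbRKBound φ u C := by
  have key : ∀ C' > C, HbRKBound φ u C' := by
    intro C' hC'
    refine memHbRK_of_kernel hφ hφmap hφ1 hu ?_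
    have hlim : Tendsto (fun r : ℝ => C' * (1 + r) ^ 2) (nhdsWithin 1 (Iio 1))
        (nhds (C' * (1 + 1) ^ 2)) :=
      ((by fun_prop : Continuous fun r : ℝ => C' * (1 + r) ^ 2).tendsto 1).mono_left
        nhdsWithin_le_nhds
    filter_upwards [Ioo_mem_nhdsLT (show (0:ℝ) < 1 by norm_num),
      hlim.eventually (lt_mem_nhds (show 4 * C < C' * (1 + 1) ^ 2 by linarith))] with r hr01 hr
    have hrD : (r : ℂ) ∈ unitDisk := by simp [mem_unitDisk, abs_of_pos hr01.1, hr01.2]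
    have hn : ‖(r : ℂ)‖ = r := by simp [abs_of_pos hr01.1]
    have hn1 : ‖(r : ℂ) - 1‖ = 1 - r := by
      rw [← Complex.ofReal_one, ← Complex.ofReal_sub, Complex.norm_real, Real.norm_eq_abs,
        abs_sub_comm, abs_of_pos (by linarith [hr01.2])]
    have h1 := h r hrD
    have h2 := one_sub_le hφmap hu hrD
    rw [hn] at h1
    rw [hn1] at h2
    set x := ‖u r‖
    have hx : 0 ≤ x := norm_nonneg _
    have h1r : 0 < 1 - r := by linarith [hr01.2]
    have hr0 := hr01.1
    have h6 : x * (x * (1 + r)) ≤ x * (2 * C) := by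
      refine le_of_mul_le_mul_right ?_ h1r
      have := mul_le_mul_of_nonneg_left h2 hC0
      nlinarith
    have h7 : x * (1 + r) ≤ 2 * C := by
      rcases hx.eq_or_lt with h0 | h0
      · rw [← h0]; linarith
      · exact le_of_mul_le_mul_left h6 h0
    have h1p : 0 < 1 + r := by linarith
    refine le_of_mul_le_mul_right ?_ h1p
    calc (1 - ‖φ r‖ ^ 2) * (1 + r) ≤ 2 * (x * (1 - r)) * (1 + r) := by gcongr
      _ = 2 * (x * (1 + r)) * (1 - r) := by ring
      _ ≤ 2 * (2 * C) * (1 - r) := by gcongr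
      _ ≤ C' * (1 + r) ^ 2 * (1 - r) := mul_le_mul_of_nonneg_right (by linarith) h1r.le
      _ = _ := by ring
  intro k lam α hl
  set B := (∑ i, ∑ j, α i * (starRingEnd ℂ) (α j) * rkKernel φ (lam i) (lam j)).re
  have hlim : Tendsto (fun C' : ℝ => C' * B) (nhdsWithin C (Ioi C)) (nhds (C * B)) :=
    ((by fun_prop : Continuous fun C' : ℝ => C' * B).tendsto C).mono_left nhdsWithin_le_nhds
  refine ge_of_tendsto hlim ?_
  filter_upwards [self_mem_nhdsWithin] with C' hC'
  exact key C' hC' k lam α hl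

lemma psd_two {E F : ℝ} {G : ℂ}
    (h : ∀ a b : ℂ, 0 ≤ ‖a‖ ^ 2 * E + ‖b‖ ^ 2 * F + 2 * (a * (starRingEnd ℂ) b * G).re) :
    0 ≤ E ∧ 0 ≤ F ∧ ‖G‖ ^ 2 ≤ E * F := by
  have hE : 0 ≤ E := by simpa using h 1 0
  have hF : 0 ≤ F := by simpa using h 0 1
  refine ⟨hE, hF, ?_⟩
  rcases eq_or_ne G 0 with rfl | hG
  · simpa using mul_nonneg hE hF
  have hG0 : 0 < ‖G‖ ^ 2 := by positivity
  have key : ∀ s : ℝ, 0 ≤ (‖G‖ ^ 2 * E) * (s * s) + (2 * ‖G‖ ^ 2) * s + F := by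
    intro s
    have h1 := h (s * (starRingEnd ℂ) G) 1
    have e : ((s : ℂ) * (starRingEnd ℂ) G * (starRingEnd ℂ) 1 * G) = ((s * ‖G‖ ^ 2 : ℝ) : ℂ) := by
      rw [map_one, mul_one, mul_assoc, mul_comm _ G, Complex.mul_conj, Complex.normSq_eq_norm_sq]
      push_cast; ring
    rw [e, Complex.ofReal_re, norm_mul, RCLike.norm_conj, Complex.norm_real, mul_pow,
      Real.norm_eq_abs, sq_abs, norm_one] at h1
    linarith
  have hd := discrim_le_zero key
  rw [discrim] at hd
  refine le_of_mul_le_mul_left ?_ hG0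
  nlinarith

lemma rk_diag {φ : ℂ → ℂ} (z : ℂ) :
    rkKernel φ z z = (((1 - ‖φ z‖ ^ 2) / (1 - ‖z‖ ^ 2) : ℝ) : ℂ) := by
  rw [rkKernel, mul_comm, Complex.mul_conj, Complex.normSq_eq_norm_sq, mul_comm, Complex.mul_conj,
    Complex.normSq_eq_norm_sq]
  push_cast; ring

lemma two_point {φ u : ℂ → ℂ} {t : ℝ} (h : HbRKBound φ u t) {z w : ℂ}
    (hz : z ∈ unitDisk) (hw : w ∈ unitDisk) :
    0 ≤ t * ((1 - ‖φ w‖ ^ 2) / (1 - ‖w‖ ^ 2)) - ‖u w‖ ^ 2 ∧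
    ‖t * rkKernel φ z w - (starRingEnd ℂ) (u z) * u w‖ ^ 2 ≤
      t * ((1 - ‖φ z‖ ^ 2) / (1 - ‖z‖ ^ 2)) *
        (t * ((1 - ‖φ w‖ ^ 2) / (1 - ‖w‖ ^ 2)) - ‖u w‖ ^ 2) := by
  have hconj : rkKernel φ w z = (starRingEnd ℂ) (rkKernel φ z w) := by
    simp only [rkKernel, map_div₀, map_sub, map_mul, map_one, Complex.conj_conj]
    ring
  have hp := psd_two (E := t * ((1 - ‖φ z‖ ^ 2) / (1 - ‖z‖ ^ 2)) - ‖u z‖ ^ 2)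
    (F := t * ((1 - ‖φ w‖ ^ 2) / (1 - ‖w‖ ^ 2)) - ‖u w‖ ^ 2)
    (G := t * rkKernel φ z w - (starRingEnd ℂ) (u z) * u w) (by
      intro a b
      have h1 := h 2 ![z, w] ![a, b] (by
        intro i; fin_cases i
        · simpa using hz
        · simpa using hw)
      simp only [Fin.sum_univ_two, Matrix.cons_val_zero, Matrix.cons_val_one] at h1
      rw [rk_diag, rk_diag, hconj] at h1
      set A := (1 - ‖φ z‖ ^ 2) / (1 - ‖z‖ ^ 2)
      set B := (1 - ‖φ w‖ ^ 2) / (1 - ‖w‖ ^ 2)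
      set k := rkKernel φ z w
      simp only [← Complex.normSq_eq_norm_sq, Complex.normSq_apply, Complex.add_re, Complex.add_im,
        Complex.mul_re, Complex.mul_im, Complex.sub_re, Complex.sub_im, Complex.conj_re,
        Complex.conj_im, Complex.ofReal_re, Complex.ofReal_im] at h1 ⊢
      linarith)
  refine ⟨hp.2.1, hp.2.2.trans ?_⟩
  exact mul_le_mul_of_nonneg_right (by linarith [sq_nonneg ‖u z‖]) hp.2.1

lemma ker_pos {φ : ℂ → ℂ} (hφ : ∀ z ∈ unitDisk, φ z ∈ unitDisk) {z : ℂ} (hz : z ∈ unitDisk) :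
    0 < (1 - ‖φ z‖ ^ 2) / (1 - ‖z‖ ^ 2) := by
  have h1 := mem_unitDisk.1 (hφ z hz)
  have h2 := mem_unitDisk.1 hz
  apply div_pos <;> nlinarith [norm_nonneg (φ z), norm_nonneg z]

lemma u_ne {φ u : ℂ → ℂ} (hφ : ∀ z ∈ unitDisk, φ z ∈ unitDisk)
    (hu : u = fun z => (φ z - 1) / (z - 1)) {z : ℂ} (hz : z ∈ unitDisk) : u z ≠ 0 := by
  rw [hu]; exact div_ne_zero (sub_one_ne (hφ z hz)) (sub_one_ne hz)

lemma nt_u {φ u : ℂ → ℂ} {K : ℝ} (hφ : MemBallHinf φ)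
    (hφmap : ∀ z ∈ unitDisk, φ z ∈ unitDisk)
    (hφ1 : NTLimit φ 1 1)
    (hφ1r : Tendsto (fun r : ℝ => φ r) (nhdsWithin 1 (Iio 1)) (nhds 1))
    (hu : u = fun z => (φ z - 1) / (z - 1))
    (hK : ∀ᶠ r : ℝ in nhdsWithin 1 (Iio 1), ‖u r‖ ≤ K) :
    ∃ t : ℂ, NTLimit u 1 t := by
  set k : ℂ → ℝ := fun z => (1 - ‖φ z‖ ^ 2) / (1 - ‖z‖ ^ 2) with hk
  have hkpos : ∀ z ∈ unitDisk, 0 < k z := fun z hz => ker_pos hφmap hz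
  set S : Set ℝ := (fun z => ‖u z‖ ^ 2 / k z) '' unitDisk with hS
  have h2K := memHbRK_of_radial hφ hφmap hφ1r hu hK
  have hbdd : BddAbove S := by
    refine ⟨2 * K, ?_⟩
    rintro _ ⟨z, hz, rfl⟩
    have := (two_point h2K hz hz).1
    simp only
    rw [div_le_iff₀ (hkpos z hz)]
    simp only [hk]; linarith
  have h0D : (0 : ℂ) ∈ unitDisk := by simp [mem_unitDisk]
  have hne : S.Nonempty := ⟨_, mem_image_of_mem _ h0D⟩
  set t : ℝ := sSup S with ht
  have hle : ∀ z ∈ unitDisk, ‖u z‖ ^ 2 ≤ t * k z := fun z hz => by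
    rw [← div_le_iff₀ (hkpos z hz)]
    exact le_csSup hbdd (mem_image_of_mem _ hz)
  have htpos : 0 < t := by
    have h1 := hle 0 h0D
    have h2 := hkpos 0 h0D
    have h3 : 0 < ‖u 0‖ ^ 2 := by
      have := norm_pos_iff.2 (u_ne hφmap hu h0D); positivity
    by_contra hcon
    nlinarith
  have hRK : HbRKBound φ u t := by
    refine rk_of_ineq hφ hφmap hφ1r hu htpos.le fun z hz => ?_
    have h1 := hle z hz
    have h2 : 0 < 1 - ‖z‖ ^ 2 := by
      have := mem_unitDisk.1 hz; nlinarith [norm_nonneg z]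
    have e : k z * (1 - ‖z‖ ^ 2) = 1 - ‖φ z‖ ^ 2 := by
      simp only [hk]; field_simp
    calc _ ≤ t * k z * (1 - ‖z‖ ^ 2) := by gcongr
      _ = _ := by rw [mul_assoc, e]
  refine ⟨t, fun M hM => ?_⟩
  -- bound of the kernel in the Stolz angle
  have hkB : ∀ z ∈ stolzAngle 1 M, k z ≤ 4 * M ^ 2 * t := by
    rintro z ⟨hz, hzM⟩
    have hz1 := mem_unitDisk.1 hz
    have h1 := hle z hz
    have h2 := one_sub_le hφmap hu hz
    have h3 : k z ≤ 2 * M * ‖u z‖ := by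
      simp only [hk]
      rw [div_le_iff₀ (by nlinarith [norm_nonneg z])]
      have hx := norm_nonneg (u z)
      have hy := norm_nonneg z
      have h4 : ‖u z‖ * ‖z - 1‖ ≤ ‖u z‖ * (M * (1 - ‖z‖)) := by gcongr
      have h5 : 0 ≤ ‖u z‖ * M * (1 - ‖z‖) * ‖z‖ := by
        have : 0 ≤ 1 - ‖z‖ := by linarith
        positivity
      nlinarith
    have hupos : 0 < ‖u z‖ := norm_pos_iff.2 (u_ne hφmap hu hz)
    have h6 : ‖u z‖ ≤ t * (2 * M) := by
      refine le_of_mul_le_mul_right ?_ hupos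
      have := mul_le_mul_of_nonneg_left h3 htpos.le
      nlinarith
    calc k z ≤ 2 * M * ‖u z‖ := h3
      _ ≤ 2 * M * (t * (2 * M)) := by gcongr
      _ = _ := by ring
  set B := 4 * M ^ 2 * t with hB
  have hBpos : 0 < B := by positivity
  rw [Metric.tendsto_nhds]
  intro η₀ hη₀
  set η := η₀ / 3 with hη
  have hηpos : 0 < η := by positivity
  set ε := min (η ^ 2 / (2 * B)) (t / 2) with hε
  have hεpos : 0 < ε := by positivity
  have hε1 : 2 * B * ε ≤ η ^ 2 := by
    have : ε ≤ η ^ 2 / (2 * B) := min_le_left _ _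
    rw [le_div_iff₀ (by positivity)] at this; linarith
  have hε2 : ε ≤ t / 2 := min_le_right _ _
  obtain ⟨_, ⟨w, hw, rfl⟩, hwt⟩ := exists_lt_of_lt_csSup hne (show t - ε < sSup S by linarith)
  simp only at hwt
  rw [lt_div_iff₀ (hkpos w hw)] at hwt
  have hupos : 0 < ‖u w‖ := norm_pos_iff.2 (u_ne hφmap hu hw)
  have hF : t * k w - ‖u w‖ ^ 2 ≤ 2 * ε / t * ‖u w‖ ^ 2 := by
    have h1 : t / 2 * k w ≤ ‖u w‖ ^ 2 := by
      have := mul_le_mul_of_nonneg_right (show t / 2 ≤ t - ε by linarith) (hkpos w hw).le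
      linarith
    have h2 : k w ≤ 2 / t * ‖u w‖ ^ 2 := by
      rw [div_mul_eq_mul_div, le_div_iff₀ htpos]; linarith
    have := mul_le_mul_of_nonneg_left h2 hεpos.le
    calc _ ≤ ε * k w := by linarith
      _ ≤ _ := this
      _ = _ := by ring
  have hlim : Tendsto (fun z => (t : ℂ) * rkKernel φ z w) (nhdsWithin 1 (stolzAngle 1 M))
      (nhds (t * u w)) := by
    refine Tendsto.const_mul _ ?_
    have hne' := sub_one_ne hw
    have hne2 : 1 - w ≠ 0 := fun h => hne' (by linear_combination -h)
    have e : u w = (1 - (starRingEnd ℂ) 1 * φ w) / (1 - (starRingEnd ℂ) 1 * w) := by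
      simp only [hu, map_one, one_mul]
      rw [div_eq_div_iff hne' hne2]; ring
    rw [e]
    unfold rkKernel
    refine Tendsto.div ?_ ?_ (by simpa using hne2)
    · exact tendsto_const_nhds.sub (((Complex.continuous_conj.tendsto 1).comp (hφ1 M hM)).mul_const _)
    · exact tendsto_const_nhds.sub (((Complex.continuous_conj.tendsto 1).mono_left
        nhdsWithin_le_nhds).mul_const _)
  filter_upwards [self_mem_nhdsWithin,
    (Metric.tendsto_nhds.1 hlim) (η * ‖u w‖) (by positivity)] with z hzS hz
  have hzD : z ∈ unitDisk := hzS.1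
  rw [dist_eq_norm] at hz ⊢
  have h1 := (two_point hRK hzD hw).2
  have h2 : ‖t * rkKernel φ z w - (starRingEnd ℂ) (u z) * u w‖ ^ 2 ≤ (η * ‖u w‖) ^ 2 := by
    refine h1.trans ?_
    have h0 := (two_point hRK hzD hw).1
    calc _ ≤ t * B * (2 * ε / t * ‖u w‖ ^ 2) := by
          refine mul_le_mul (mul_le_mul_of_nonneg_left (hkB z hzS) htpos.le) hF h0 (by positivity)
      _ = 2 * B * ε * ‖u w‖ ^ 2 := by field_simp
      _ ≤ η ^ 2 * ‖u w‖ ^ 2 := by gcongr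
      _ = _ := by ring
  have h3 := abs_le_of_sq_le_sq h2 (by positivity)
  rw [abs_of_nonneg (norm_nonneg _)] at h3
  have h4 : ‖(starRingEnd ℂ) (u z) * u w - t * u w‖ ≤ 2 * η * ‖u w‖ := by
    have := norm_sub_le (t * rkKernel φ z w - t * u w)
      (t * rkKernel φ z w - (starRingEnd ℂ) (u z) * u w)
    rw [show t * rkKernel φ z w - t * u w - (t * rkKernel φ z w - (starRingEnd ℂ) (u z) * u w) =
      (starRingEnd ℂ) (u z) * u w - t * u w by ring] at this
    linarith
  rw [← sub_mul, norm_mul] at h4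
  have h5 := le_of_mul_le_mul_right h4 hupos
  have h6 : ‖(starRingEnd ℂ) (u z) - t‖ = ‖u z - t‖ := by
    rw [← RCLike.norm_conj (u z - t), map_sub, Complex.conj_ofReal]
  rw [h6] at h5
  linarith

lemma nt_deriv {φ u : ℂ → ℂ} (hφ : DifferentiableOn ℂ φ unitDisk)
    (hu : u = fun z => (φ z - 1) / (z - 1)) {t : ℂ} (ht : NTLimit u 1 t) :
    NTLimit (deriv φ) 1 t := by
  intro M hM
  have hopen : IsOpen unitDisk := Metric.isOpen_ball
  have hud : DifferentiableOn ℂ u unitDisk := by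
    rw [hu]
    exact (hφ.sub_const 1).div (differentiableOn_id.sub_const 1) fun z hz => sub_one_ne hz
  have hder : ∀ z ∈ unitDisk, deriv φ z = u z + (z - 1) * deriv u z := by
    intro z hz
    have hev : φ =ᶠ[nhds z] fun y => 1 + (y - 1) * u y := by
      filter_upwards [hopen.mem_nhds hz] with y hy
      have := u_mul hu hy
      linear_combination -this
    rw [hev.deriv_eq]
    have hd := ((hud.differentiableAt (hopen.mem_nhds hz)).hasDerivAt)
    have := (((hasDerivAt_id z).sub_const 1).mul hd).const_add 1
    have e := this.deriv
    simp only [Pi.mul_def, id, one_mul] at e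
    exact e
  have hsmall : Tendsto (fun z => (z - 1) * deriv u z) (nhdsWithin 1 (stolzAngle 1 M)) (nhds 0) := by
    rw [Metric.tendsto_nhds]
    intro η hη
    have hM0 : 0 < M := by linarith
    have h1 := (Metric.tendsto_nhds.1 (ht (2 * M + 1) (by linarith))) (η / (4 * M)) (by positivity)
    rw [eventually_nhdsWithin_iff, Metric.eventually_nhds_iff] at h1
    obtain ⟨δ, hδ, h1⟩ := h1
    rw [eventually_nhdsWithin_iff, Metric.eventually_nhds_iff]
    refine ⟨δ / 2, by positivity, fun z hzδ hzS => ?_⟩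
    obtain ⟨hzD, hzM⟩ := hzS
    have hz1 := mem_unitDisk.1 hzD
    rw [dist_eq_norm] at hzδ
    set ρ := (1 - ‖z‖) / 2 with hρ
    have hρ0 : 0 < ρ := by rw [hρ]; linarith
    have hz2 : 1 - ‖z‖ ≤ ‖z - 1‖ := by
      have := norm_sub_norm_le (1 : ℂ) z
      rw [norm_one, norm_sub_rev] at this; exact this
    have hball : ∀ y ∈ Metric.closedBall z ρ, y ∈ stolzAngle 1 (2 * M + 1) ∧ dist y 1 < δ := by
      intro y hy
      rw [Metric.mem_closedBall, dist_eq_norm] at hy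
      have h3 : ‖y‖ ≤ ‖z‖ + ρ := by
        have := norm_add_le z (y - z)
        rw [add_sub_cancel] at this; linarith
      have h4 : ‖y - 1‖ ≤ ‖z - 1‖ + ρ := by
        have := norm_add_le (z - 1) (y - z)
        rw [show z - 1 + (y - z) = y - 1 by ring] at this; linarith
      refine ⟨⟨mem_unitDisk.2 (by linarith), ?_⟩, ?_⟩
      · have h5 : ρ ≤ 1 - ‖y‖ := by linarith
        calc ‖y - 1‖ ≤ M * (1 - ‖z‖) + ρ := by linarith
          _ = (2 * M + 1) * ρ := by rw [hρ]; ring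
          _ ≤ _ := by gcongr
      · rw [dist_eq_norm]; linarith
    have hsub : Metric.closedBall z ρ ⊆ unitDisk := fun y hy => (hball y hy).1.1
    have hC := Complex.norm_deriv_le_of_forall_mem_sphere_norm_le (f := fun y => u y - t) (c := z)
      (R := ρ) (C := η / (4 * M)) hρ0
      (DifferentiableOn.diffContOnCl (by
        rw [closure_ball z hρ0.ne']
        exact (hud.mono hsub).sub_const t)) (by
        intro y hy
        have := hball y (Metric.sphere_subset_closedBall hy)
        have h5 := h1 this.2 this.1
        rw [dist_eq_norm] at h5; exact h5.le)
    rw [deriv_sub_const] at hC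
    rw [dist_eq_norm, sub_zero, norm_mul]
    calc ‖z - 1‖ * ‖deriv u z‖ ≤ (M * (1 - ‖z‖)) * (η / (4 * M) / ρ) := by gcongr
      _ = η / 2 := by
        have : 1 - ‖z‖ = 2 * ρ := by rw [hρ]; ring
        rw [this]; field_simp; norm_num
      _ < η := by linarith
  have := (ht M hM).add hsmall
  rw [add_zero] at this
  refine this.congr' ?_
  filter_upwards [self_mem_nhdsWithin] with z hz
  exact (hder z hz.1).symm

lemma radial_of_adc {φ u : ℂ → ℂ} (hφ : DifferentiableOn ℂ φ unitDisk)
    (hφ1 : Tendsto (fun r : ℝ => φ r) (nhdsWithin 1 (Iio 1)) (nhds 1))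
    (hu : u = fun z => (φ z - 1) / (z - 1)) (h : HasADC φ 1) :
    ∃ K : ℝ, ∀ᶠ r : ℝ in nhdsWithin 1 (Iio 1), ‖u r‖ ≤ K := by
  obtain ⟨L, L', -, -, hL'⟩ := h
  have hopen : IsOpen unitDisk := Metric.isOpen_ball
  have h1 := ((hL' 2 (by norm_num)).comp radial_stolz).norm
  have h2 := h1.eventually (gt_mem_nhds (lt_add_one ‖L'‖))
  set K := ‖L'‖ + 1
  refine ⟨K, ?_⟩
  rw [eventually_nhdsWithin_iff, Metric.eventually_nhds_iff] at h2
  obtain ⟨δ, hδ, h2⟩ := h2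
  have hm : Ioo (max 0 (1 - δ)) 1 ∈ nhdsWithin (1:ℝ) (Iio 1) :=
    Ioo_mem_nhdsLT (max_lt (by norm_num) (by linarith))
  have hsD : ∀ s ∈ Ioo (max 0 (1 - δ)) 1, (s : ℂ) ∈ unitDisk := by
    intro s hs
    have h0 : 0 < s := (le_max_left _ _).trans_lt hs.1
    simp [mem_unitDisk, abs_of_pos h0, hs.2]
  have hd : ∀ s ∈ Ioo (max 0 (1 - δ)) 1, ‖deriv φ (s : ℂ)‖ ≤ K := by
    intro s hs
    have h0 : 1 - δ < s := (le_max_right _ _).trans_lt hs.1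
    refine (h2 (y := s) ?_ hs.2).le
    rw [Real.dist_eq, abs_lt]; constructor <;> linarith [hs.2]
  filter_upwards [hm] with r hr
  have hb : ∀ s ∈ Ioo (max 0 (1 - δ)) 1, ‖φ s - φ r‖ ≤ K * ‖s - r‖ := by
    intro s hs
    refine (convex_Ioo (max 0 (1 - δ)) 1).norm_image_sub_le_of_norm_hasDerivWithin_le
      (f := fun x : ℝ => φ x) (f' := fun x : ℝ => deriv φ (x : ℂ)) ?_ hd hr hs
    intro x hx
    exact ((hφ.differentiableAt (hopen.mem_nhds (hsD x hx))).hasDerivAt.comp_ofReal).hasDerivWithinAt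
  have hl1 : Tendsto (fun s : ℝ => ‖φ s - φ r‖) (nhdsWithin 1 (Iio 1)) (nhds ‖1 - φ r‖) :=
    (hφ1.sub_const _).norm
  have hl2 : Tendsto (fun s : ℝ => K * ‖s - r‖) (nhdsWithin 1 (Iio 1)) (nhds (K * ‖1 - r‖)) :=
    ((by fun_prop : Continuous fun s : ℝ => K * ‖s - r‖).tendsto 1).mono_left nhdsWithin_le_nhds
  have h3 : ‖1 - φ r‖ ≤ K * ‖1 - r‖ := by
    refine le_of_tendsto_of_tendsto hl1 hl2 ?_
    filter_upwards [hm] with s hs using hb s hs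
  have hr1 : 0 < 1 - r := by linarith [hr.2]
  have hn1 : ‖(r : ℂ) - 1‖ = ‖1 - r‖ := by
    rw [← Complex.ofReal_one, ← Complex.ofReal_sub, Complex.norm_real, norm_sub_rev]
  simp only [hu]
  rw [norm_div, hn1, norm_sub_rev, div_le_iff₀ (by rw [Real.norm_of_nonneg hr1.le]; exact hr1)]
  exact h3

/-- Corollary 4.10. For `b(z) = (1+z)/2` (so `a₁(z) = z − 1`) and
`φ ∈ H(b) ∩ ball(H^∞)` with non-tangential limit `φ(1) = 1`, with
`u(z) = (φ(z) − 1)/(z − 1)`: `C_φ` is bounded on `H(b)` iff `φ` has an ADC at `1` iff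
`u ∈ H(φ)`. -/
theorem sarason_silva_charact
    (b : ℂ → ℂ) (hb : b = fun z => (1 + z) / 2)
    (φ : ℂ → ℂ) (hφb : MemHb (fun _ : Fin 1 => (1:ℂ)) (fun _ => 1) φ)
    (hφball : MemBallHinf φ)
    (hφmap : ∀ z ∈ unitDisk, φ z ∈ unitDisk)
    (hφ1 : NTLimit φ 1 1)
    (u : ℂ → ℂ) (hu : u = fun z => (φ z - 1) / (z - 1)) :
    (CompBddHb (fun _ : Fin 1 => (1:ℂ)) (fun _ => 1) φ ↔ HasADC φ 1) ∧
    (CompBddHb (fun _ : Fin 1 => (1:ℂ)) (fun _ => 1) φ ↔ MemHbRK φ u) := by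
  have hrad : Tendsto (fun r : ℝ => φ r) (nhdsWithin 1 (Iio 1)) (nhds 1) :=
    (hφ1 2 (by norm_num)).comp radial_stolz
  have toRK : (∃ K : ℝ, ∀ᶠ r : ℝ in nhdsWithin 1 (Iio 1), ‖u r‖ ≤ K) → MemHbRK φ u :=
    fun ⟨K, hK⟩ => ⟨2 * K, memHbRK_of_radial hφball hφmap hrad hu hK⟩
  refine ⟨⟨fun h => ?_, fun h => ?_⟩, ⟨fun h => ?_, fun h => comp_of_rk hφball hφmap hu h⟩⟩
  · obtain ⟨K, hK⟩ := radial_of_comp hφb hφball.1 hφmap hrad hu h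
    obtain ⟨t, ht⟩ := nt_u hφball hφmap hφ1 hrad hu hK
    exact ⟨1, t, by simp, hφ1, nt_deriv hφball.1 hu ht⟩
  · exact comp_of_rk hφball hφmap hu (toRK (radial_of_adc hφball.1 hrad hu h))
  · exact toRK (radial_of_comp hφb hφball.1 hφmap hrad hu h)

end
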